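/- Let ℓ be a prime and let G and H be subgroups of GL₂(ℤ/ℓℤ) such that sig(G) = sig(H), G and H are not conjugate in GL₂(ℓ), and G contains no element of order ℓ. Then |z(G) − z(H)| ≥ 1/4. -/

import Mathlib

open Matrix

/-- `GL₂(ℤ/ℓℤ)`. -/
abbrev GL2 (ℓ : ℕ) := GL (Fin 2) (ZMod ℓ)

/-- The underlying matrix of an element of `GL₂(ℤ/ℓℤ)`. -/
def mat {ℓ : ℕ} (g : GL2 ℓ) : Matrix (Fin 2) (Fin 2) (ZMod ℓ) := g

/-- `dim₁ g`, the dimension of the eigenspace `ker(g − 1)` of `g` acting on `(ℤ/ℓℤ)²`. -/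
noncomputable def dimOne {ℓ : ℕ} (g : GL2 ℓ) : ℕ :=
  Module.finrank (ZMod ℓ) (LinearMap.ker (Matrix.toLin' (mat g - 1)))

/-- `sig(g) = (det g, tr g, dim₁ g)`. -/
noncomputable def sigOf {ℓ : ℕ} (g : GL2 ℓ) : ZMod ℓ × ZMod ℓ × ℕ :=
  ((mat g).det, (mat g).trace, dimOne g)

/-- The signature `sig(G) = {sig(g) : g ∈ G}` of a subgroup of `GL₂(ℤ/ℓℤ)`. -/
noncomputable def sigSet {ℓ : ℕ} (G : Subgroup (GL2 ℓ)) : Set (ZMod ℓ × ZMod ℓ × ℕ) :=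
  {s | ∃ g ∈ G, sigOf g = s}

/-- `z(G)`, the proportion of trace-zero elements of `G`, as a rational number. -/
noncomputable def zRatio {ℓ : ℕ} (G : Subgroup (GL2 ℓ)) : ℚ :=
  (Nat.card {g : G // (mat (g : GL2 ℓ)).trace = 0} : ℚ) / (Nat.card G : ℚ)

/-- Subgroups `H`, `K` of `GL₂(ℤ/ℓℤ)` are conjugate if `K = gHg⁻¹` for some `g`. -/
def ConjSub {ℓ : ℕ} (H K : Subgroup (GL2 ℓ)) : Prop :=
  ∃ c : GL2 ℓ, Subgroup.map (MulAut.conj c).toMonoidHom H = K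

/-- A `2 × 2` matrix is scalar. -/
def IsScal {F : Type*} [Field F] (A : Matrix (Fin 2) (Fin 2) F) : Prop :=
  A 0 1 = 0 ∧ A 1 0 = 0 ∧ A 0 0 = A 1 1

section TwoByTwo

variable {F : Type*} [Field F]

theorem isScal_iff {A : Matrix (Fin 2) (Fin 2) F} : IsScal A ↔ ∃ a : F, A = a • 1 := by
  constructor
  · rintro ⟨h1, h2, h3⟩
    refine ⟨A 0 0, ?_⟩
    ext i j
    fin_cases i <;> fin_cases j <;> simp [h1, h2, h3]
  · rintro ⟨a, rfl⟩
    simp [IsScal]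

theorem IsScal.commute {A : Matrix (Fin 2) (Fin 2) F} (h : IsScal A)
    (B : Matrix (Fin 2) (Fin 2) F) : A * B = B * A := by
  obtain ⟨a, rfl⟩ := isScal_iff.1 h
  simp

theorem exists_eq_of_commute {A B : Matrix (Fin 2) (Fin 2) F} (hA : ¬ IsScal A)
    (h : B * A = A * B) : ∃ a b : F, B = a • 1 + b • A := by
  have e00 := congrFun (congrFun h 0) 0
  have e01 := congrFun (congrFun h 0) 1
  have e10 := congrFun (congrFun h 1) 0
  have e11 := congrFun (congrFun h 1) 1
  simp only [Matrix.mul_apply, Fin.sum_univ_two] at e00 e01 e10 e11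
  have key : ∀ a b : F, B 0 0 = a + b * A 0 0 → B 0 1 = b * A 0 1 → B 1 0 = b * A 1 0 →
      B 1 1 = a + b * A 1 1 → ∃ a b : F, B = a • 1 + b • A := by
    intro a b h1 h2 h3 h4
    refine ⟨a, b, ?_⟩
    ext i j
    fin_cases i <;> fin_cases j <;> simp [h1, h2, h3, h4]
  by_cases h1 : A 0 1 = 0
  · by_cases h2 : A 1 0 = 0
    · have h3 : A 0 0 - A 1 1 ≠ 0 := fun h3 => hA ⟨h1, h2, sub_eq_zero.1 h3⟩
      apply key (B 0 0 - (B 0 0 - B 1 1) / (A 0 0 - A 1 1) * A 0 0)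
        ((B 0 0 - B 1 1) / (A 0 0 - A 1 1)) <;> field_simp <;> grind
    · apply key (B 0 0 - B 1 0 / A 1 0 * A 0 0) (B 1 0 / A 1 0) <;> field_simp <;> grind
  · apply key (B 0 0 - B 0 1 / A 0 1 * A 0 0) (B 0 1 / A 0 1) <;> field_simp <;> grind

theorem commute_trans {A B C : Matrix (Fin 2) (Fin 2) F} (hA : ¬ IsScal A)
    (hB : B * A = A * B) (hC : C * A = A * C) : B * C = C * B := by
  obtain ⟨a, b, rfl⟩ := exists_eq_of_commute hA hB
  simp [add_mul, mul_add, hC]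

theorem sq_eq (A : Matrix (Fin 2) (Fin 2) F) : A * A = A.trace • A - A.det • 1 := by
  ext i j
  fin_cases i <;> fin_cases j <;>
    simp [Matrix.mul_apply, Fin.sum_univ_two, Matrix.trace_fin_two, Matrix.det_fin_two] <;> ring

theorem isScal_smul_sub {A : Matrix (Fin 2) (Fin 2) F} (hA : ¬ IsScal A) {a b : F}
    (h : IsScal (a • A - b • 1)) : a = 0 := by
  by_contra ha
  obtain ⟨h1, h2, h3⟩ := h
  simp at h1 h2 h3
  exact hA ⟨by tauto, by tauto, by tauto⟩

theorem pow_three_eq (A : Matrix (Fin 2) (Fin 2) F) :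
    A ^ 3 = (A.trace ^ 2 - A.det) • A - (A.trace * A.det) • 1 := by
  rw [pow_succ, pow_two, sq_eq, sub_mul, smul_mul_assoc, sq_eq]
  simp only [smul_sub, smul_smul, sub_smul, smul_mul_assoc, one_mul]
  module

theorem pow_four_eq (A : Matrix (Fin 2) (Fin 2) F) :
    A ^ 4 = (A.trace * (A.trace ^ 2 - 2 * A.det)) • A
      - ((A.trace ^ 2 - A.det) * A.det) • 1 := by
  rw [pow_succ, pow_three_eq, sub_mul, smul_mul_assoc, sq_eq]
  simp only [smul_sub, smul_smul, smul_mul_assoc, one_mul]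
  module

theorem pow_five_eq (A : Matrix (Fin 2) (Fin 2) F) :
    A ^ 5 = (A.trace ^ 4 - 3 * A.trace ^ 2 * A.det + A.det ^ 2) • A
      - (A.trace * (A.trace ^ 2 - 2 * A.det) * A.det) • 1 := by
  rw [pow_succ, pow_four_eq, sub_mul, smul_mul_assoc, sq_eq]
  simp only [smul_sub, smul_smul, smul_mul_assoc, one_mul]
  module

/-- Two vectors in the kernel of a nonzero `2 × 2` matrix are proportional. -/
theorem exists_smul_of_mulVec_eq_zero {C : Matrix (Fin 2) (Fin 2) F} (hC : C ≠ 0)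
    {v w : Fin 2 → F} (hv0 : v ≠ 0) (hv : C *ᵥ v = 0) (hw : C *ᵥ w = 0) : ∃ a : F, w = a • v := by
  have hdet : v 0 * w 1 - v 1 * w 0 = 0 := by
    by_contra hne
    apply hC
    have a0 := congrFun hv 0
    have a1 := congrFun hv 1
    have b0 := congrFun hw 0
    have b1 := congrFun hw 1
    simp [Matrix.mulVec, dotProduct, Fin.sum_univ_two] at a0 a1 b0 b1
    have key : ∀ i, C i 0 * v 0 + C i 1 * v 1 = 0 → C i 0 * w 0 + C i 1 * w 1 = 0 →
        C i 0 = 0 ∧ C i 1 = 0 := by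
      intro i h1 h2
      constructor
      · apply (mul_eq_zero.1 (_ : (v 0 * w 1 - v 1 * w 0) * C i 0 = 0)).resolve_left hne
        linear_combination w 1 * h1 - v 1 * h2
      · apply (mul_eq_zero.1 (_ : (v 0 * w 1 - v 1 * w 0) * C i 1 = 0)).resolve_left hne
        linear_combination v 0 * h2 - w 0 * h1
    ext i j
    fin_cases i <;> fin_cases j
    · exact (key 0 a0 b0).1
    · exact (key 0 a0 b0).2
    · exact (key 1 a1 b1).1
    · exact (key 1 a1 b1).2
  by_cases h0 : v 0 = 0
  · have h1 : v 1 ≠ 0 := by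
      intro h1
      apply hv0
      ext i
      fin_cases i <;> simp [h0, h1]
    have hw0 : w 0 = 0 := by simpa [h0, h1] using hdet
    refine ⟨w 1 / v 1, ?_⟩
    ext i
    fin_cases i <;> simp [h0, hw0, h1]
  · refine ⟨w 0 / v 0, ?_⟩
    ext i
    fin_cases i
    · simp [h0]
    · simp
      field_simp
      linear_combination hdet

/-- A nonzero intertwiner between two pairs of matrices is invertible as soon as the commutator of
the first pair is. -/
theorem det_ne_zero_of_intertwine {C X Y X' Y' : Matrix (Fin 2) (Fin 2) F} (hC : C ≠ 0)
    (hX : C * X = X' * C) (hY : C * Y = Y' * C) (hXY : (X * Y - Y * X).det ≠ 0) : C.det ≠ 0 := by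
  intro h0
  obtain ⟨v, hv0, hv⟩ := Matrix.exists_mulVec_eq_zero_iff.2 h0
  obtain ⟨a, ha⟩ := exists_smul_of_mulVec_eq_zero hC hv0 hv (w := X *ᵥ v)
    (by rw [Matrix.mulVec_mulVec, hX, ← Matrix.mulVec_mulVec, hv, Matrix.mulVec_zero])
  obtain ⟨b, hb⟩ := exists_smul_of_mulVec_eq_zero hC hv0 hv (w := Y *ᵥ v)
    (by rw [Matrix.mulVec_mulVec, hY, ← Matrix.mulVec_mulVec, hv, Matrix.mulVec_zero])
  apply hXY
  apply Matrix.exists_mulVec_eq_zero_iff.1 ⟨v, hv0, ?_⟩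
  rw [Matrix.sub_mulVec, ← Matrix.mulVec_mulVec, ← Matrix.mulVec_mulVec, ha, hb,
    Matrix.mulVec_smul, Matrix.mulVec_smul, ha, hb, smul_smul, smul_smul, mul_comm, sub_self]

/-- A non-scalar `2 × 2` matrix is similar to its companion matrix. -/
theorem exists_companion {A : Matrix (Fin 2) (Fin 2) F} (hA : ¬ IsScal A) :
    ∃ P : Matrix (Fin 2) (Fin 2) F, P.det ≠ 0 ∧ A * P = P * !![0, -A.det; 1, A.trace] := by
  have key : ∀ v w : F, (v * (A 1 0 * v + A 1 1 * w) - w * (A 0 0 * v + A 0 1 * w)) ≠ 0 →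
      ∃ P : Matrix (Fin 2) (Fin 2) F, P.det ≠ 0 ∧ A * P = P * !![0, -A.det; 1, A.trace] := by
    intro v w h
    refine ⟨!![v, A 0 0 * v + A 0 1 * w; w, A 1 0 * v + A 1 1 * w], ?_, ?_⟩
    · rw [Matrix.det_fin_two_of]
      intro h'
      apply h
      linear_combination h'
    · ext i j
      fin_cases i <;> fin_cases j <;>
        simp [Matrix.mul_apply, Fin.sum_univ_two, Matrix.trace_fin_two, Matrix.det_fin_two] <;> ring
  by_cases h1 : A 1 0 = 0
  · by_cases h2 : A 0 1 = 0
    · apply key 1 1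
      intro h3
      apply hA ⟨h2, h1, ?_⟩
      rw [h1, h2] at h3
      linear_combination -h3
    · apply key 0 1
      simpa using h2
  · apply key 1 0
    simpa using h1

theorem exists_similar_matrix {A B : Matrix (Fin 2) (Fin 2) F} (hA : ¬ IsScal A) (hB : ¬ IsScal B)
    (ht : A.trace = B.trace) (hd : A.det = B.det) :
    ∃ C : Matrix (Fin 2) (Fin 2) F, C.det ≠ 0 ∧ C * A = B * C := by
  obtain ⟨P, hP, hAP⟩ := exists_companion hA
  obtain ⟨Q, hQ, hBQ⟩ := exists_companion hB
  refine ⟨Q * P.adjugate, ?_, ?_⟩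
  · simp [Matrix.det_mul, Matrix.det_adjugate, hP, hQ]
  · rw [← ht, ← hd] at hBQ
    generalize !![0, -A.det; 1, A.trace] = D at hAP hBQ
    have hP' : P * P.adjugate = P.det • 1 := Matrix.mul_adjugate P
    have hP'' : P.adjugate * P = P.det • 1 := Matrix.adjugate_mul P
    have h1 : P.det • (P.adjugate * A) = P.det • (D * P.adjugate) := by
      calc P.det • (P.adjugate * A) = P.adjugate * (A * P) * P.adjugate := by
            rw [mul_assoc, mul_assoc A, hP']; simp
        _ = _ := by rw [hAP, ← mul_assoc, hP'']; simp
    have h2 := smul_right_injective _ hP h1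
    rw [mul_assoc, h2, ← mul_assoc, ← hBQ, mul_assoc]

theorem exists_similar_pair_companion {t d : F} {Y Y' : Matrix (Fin 2) (Fin 2) F}
    (ht : Y.trace = Y'.trace) (hd : Y.det = Y'.det)
    (hXY : (!![0, -d; 1, t] * Y).trace = (!![0, -d; 1, t] * Y').trace) :
    ∃ C : Matrix (Fin 2) (Fin 2) F, C ≠ 0 ∧ C * !![0, -d; 1, t] = !![0, -d; 1, t] * C ∧
      C * Y = Y' * C := by
  by_cases hYY : Y = Y'
  · exact ⟨1, one_ne_zero, by simp, by simp [hYY]⟩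
  simp [Matrix.trace_fin_two, Matrix.det_fin_two, Fin.sum_univ_two,
    Matrix.vecMul, dotProduct] at ht hd hXY
  have h11 : Y' 1 1 = Y 0 0 + Y 1 1 - Y' 0 0 := by linear_combination -ht
  have h01 : Y' 0 1 = Y 0 1 + d * (Y' 1 0 - Y 1 0) + t * (Y' 0 0 - Y 0 0) := by
    linear_combination -hXY + t * ht
  rw [h11, h01] at hd
  have key : ∀ α β : F, (α ≠ 0 ∨ β ≠ 0) →
      (α = Y' 0 0 - Y 1 1 + t * Y 1 0 ∧ β = Y' 1 0 - Y 1 0 ∨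
        α = d * Y 1 0 + Y' 0 1 ∧ β = Y 0 0 - Y' 0 0) →
      ∃ C : Matrix (Fin 2) (Fin 2) F, C ≠ 0 ∧ C * !![0, -d; 1, t] = !![0, -d; 1, t] * C ∧
      C * Y = Y' * C := by
    intro α β hne h
    refine ⟨!![α, -d * β; β, α + t * β], ?_, ?_, ?_⟩
    · intro h0
      have e1 := congrFun (congrFun h0 0) 0
      have e2 := congrFun (congrFun h0 1) 0
      simp at e1 e2
      tauto
    · ext i j
      fin_cases i <;> fin_cases j <;> simp [Matrix.mul_apply, Fin.sum_univ_two] <;> ring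
    · ext i j
      rcases h with ⟨rfl, rfl⟩ | ⟨rfl, rfl⟩ <;> fin_cases i <;> fin_cases j <;>
        simp [Matrix.mul_apply, Fin.sum_univ_two, h11, h01] <;> grind
  by_cases h1 : Y 0 0 = Y' 0 0
  · by_cases h2 : Y 1 0 = Y' 1 0
    · exfalso
      apply hYY
      ext i j
      fin_cases i <;> fin_cases j <;> simp <;> grind
    · exact key _ _ (Or.inr (sub_ne_zero.2 (Ne.symm h2))) (Or.inl ⟨rfl, rfl⟩)
  · exact key _ _ (Or.inr (sub_ne_zero.2 h1)) (Or.inr ⟨rfl, rfl⟩)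

theorem exists_similar_pair_matrix {X Y X' Y' : Matrix (Fin 2) (Fin 2) F}
    (htX : X.trace = X'.trace) (hdX : X.det = X'.det) (htY : Y.trace = Y'.trace)
    (hdY : Y.det = Y'.det) (hXY : (X * Y).trace = (X' * Y').trace)
    (hne : (X * Y - Y * X).det ≠ 0) (hX' : ¬ IsScal X') :
    ∃ C : Matrix (Fin 2) (Fin 2) F, C.det ≠ 0 ∧ C * X = X' * C ∧ C * Y = Y' * C := by
  have hX : ¬ IsScal X := fun h => hne (by rw [h.commute Y]; simp)
  obtain ⟨P, hP, hXP⟩ := exists_companion hX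
  obtain ⟨Q, hQ, hXQ⟩ := exists_companion hX'
  rw [← htX, ← hdX] at hXQ
  have hP1 : P * P⁻¹ = 1 := Matrix.mul_nonsing_inv P (isUnit_iff_ne_zero.2 hP)
  have hP2 : P⁻¹ * P = 1 := Matrix.nonsing_inv_mul P (isUnit_iff_ne_zero.2 hP)
  have hQ1 : Q * Q⁻¹ = 1 := Matrix.mul_nonsing_inv Q (isUnit_iff_ne_zero.2 hQ)
  have hQ2 : Q⁻¹ * Q = 1 := Matrix.nonsing_inv_mul Q (isUnit_iff_ne_zero.2 hQ)
  have conj_trace : ∀ {R S : Matrix (Fin 2) (Fin 2) F} (A : Matrix (Fin 2) (Fin 2) F),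
      S * R = 1 → (R * A * S).trace = A.trace := by
    intro R S A h
    rw [Matrix.trace_mul_comm, ← mul_assoc, h, one_mul]
  have conj_det : ∀ {R S : Matrix (Fin 2) (Fin 2) F} (A : Matrix (Fin 2) (Fin 2) F),
      S * R = 1 → (R * A * S).det = A.det := by
    intro R S A h
    rw [Matrix.det_mul_comm, ← mul_assoc, h, one_mul]
  have hD : P⁻¹ * X * P = !![0, -X.det; 1, X.trace] := by
    rw [mul_assoc, hXP, ← mul_assoc, hP2, one_mul]
  have hD' : Q⁻¹ * X' * Q = !![0, -X.det; 1, X.trace] := by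
    rw [mul_assoc, hXQ, ← mul_assoc, hQ2, one_mul]
  obtain ⟨C, hC, hCX, hCY⟩ := exists_similar_pair_companion (t := X.trace) (d := X.det)
    (Y := P⁻¹ * Y * P) (Y' := Q⁻¹ * Y' * Q)
    (by rw [conj_trace _ hP1, conj_trace _ hQ1, htY])
    (by rw [conj_det _ hP1, conj_det _ hQ1, hdY])
    (by
      have h1 : !![0, -X.det; 1, X.trace] * (P⁻¹ * Y * P) = P⁻¹ * (X * Y) * P := by
        rw [← hD, mul_assoc (P⁻¹ * X), mul_assoc P⁻¹ Y, ← mul_assoc P, hP1, one_mul]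
        simp only [mul_assoc]
      have h2 : !![0, -X.det; 1, X.trace] * (Q⁻¹ * Y' * Q) = Q⁻¹ * (X' * Y') * Q := by
        rw [← hD', mul_assoc (Q⁻¹ * X'), mul_assoc Q⁻¹ Y', ← mul_assoc Q, hQ1, one_mul]
        simp only [mul_assoc]
      rw [h1, h2, conj_trace _ hP1, conj_trace _ hQ1, hXY])
  generalize !![0, -X.det; 1, X.trace] = D at *
  have eX : Q * C * P⁻¹ * X = X' * (Q * C * P⁻¹) := by
    have h1 : P⁻¹ * X = D * P⁻¹ := by rw [← hD, mul_assoc _ P, hP1, mul_one]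
    rw [mul_assoc, h1, ← mul_assoc, mul_assoc Q, hCX, ← mul_assoc Q, ← hXQ]
    simp only [mul_assoc]
  have eY : Q * C * P⁻¹ * Y = Y' * (Q * C * P⁻¹) := by
    have h1 : P⁻¹ * Y = P⁻¹ * Y * P * P⁻¹ := by rw [mul_assoc _ P, hP1, mul_one]
    rw [mul_assoc, h1, ← mul_assoc, mul_assoc Q, hCY, ← mul_assoc Q, ← mul_assoc Q,
      ← mul_assoc Q, hQ1, one_mul]
    simp only [mul_assoc]
  refine ⟨Q * C * P⁻¹, det_ne_zero_of_intertwine ?_ eX eY hne, eX, eY⟩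
  intro h0
  apply hC
  calc C = Q⁻¹ * (Q * C * P⁻¹) * P := by
        rw [mul_assoc Q⁻¹, mul_assoc _ P⁻¹, hP2, mul_one, ← mul_assoc, hQ2, one_mul]
    _ = 0 := by rw [h0]; simp

theorem exists_similar {x y : GL (Fin 2) F} (hx : ¬ IsScal x.val) (hy : ¬ IsScal y.val)
    (ht : x.val.trace = y.val.trace) (hd : x.val.det = y.val.det) :
    ∃ c : GL (Fin 2) F, c * x * c⁻¹ = y := by
  obtain ⟨C, hC, h⟩ := exists_similar_matrix hx hy ht hd
  refine ⟨Matrix.GeneralLinearGroup.mkOfDetNeZero C hC, ?_⟩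
  rw [mul_inv_eq_iff_eq_mul]
  exact Units.ext h

theorem exists_similar_pair {x y x' y' : GL (Fin 2) F}
    (htx : x.val.trace = x'.val.trace) (hdx : x.val.det = x'.val.det)
    (hty : y.val.trace = y'.val.trace) (hdy : y.val.det = y'.val.det)
    (hxy : (x * y).val.trace = (x' * y').val.trace)
    (hne : (x.val * y.val - y.val * x.val).det ≠ 0) (hx' : ¬ IsScal x'.val) :
    ∃ c : GL (Fin 2) F, c * x * c⁻¹ = x' ∧ c * y * c⁻¹ = y' := by
  obtain ⟨C, hC, h1, h2⟩ := exists_similar_pair_matrix htx hdx hty hdy hxy hne hx'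
  refine ⟨Matrix.GeneralLinearGroup.mkOfDetNeZero C hC, ?_, ?_⟩
  · rw [mul_inv_eq_iff_eq_mul]
    exact Units.ext h1
  · rw [mul_inv_eq_iff_eq_mul]
    exact Units.ext h2

end TwoByTwo

section ProjectiveOrder

variable {F : Type*} [Field F]

theorem isScal_iff_mem_center {g : GL (Fin 2) F} :
    IsScal g.val ↔ g ∈ Subgroup.center (GL (Fin 2) F) := by
  rw [Subgroup.mem_center_iff]
  constructor
  · intro h k
    exact Units.ext (h.commute k.val).symm
  · intro h
    have h1 := congrArg Units.val
      (h (Matrix.GeneralLinearGroup.mkOfDetNeZero !![1, 1; 0, 1] (by simp)))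
    have h2 := congrArg Units.val
      (h (Matrix.GeneralLinearGroup.mkOfDetNeZero !![1, 0; 1, 1] (by simp)))
    simp only [Units.val_mul, Matrix.GeneralLinearGroup.mkOfDetNeZero] at h1 h2
    have a1 := congrFun (congrFun h1 0) 0
    have a2 := congrFun (congrFun h1 0) 1
    have a3 := congrFun (congrFun h2 0) 0
    simp [Matrix.mul_apply, Fin.sum_univ_two] at a1 a2 a3
    refine ⟨a3, a1, by linear_combination -a2⟩

/-- The order of the image of `g` in the projective linear group. -/
noncomputable def pord (g : GL (Fin 2) F) : ℕ :=
  orderOf (QuotientGroup.mk' (Subgroup.center (GL (Fin 2) F)) g)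

theorem isScal_pow_iff {g : GL (Fin 2) F} {k : ℕ} : IsScal (g ^ k).val ↔ pord g ∣ k := by
  rw [isScal_iff_mem_center, pord, orderOf_dvd_iff_pow_eq_one, ← map_pow]
  exact (QuotientGroup.eq_one_iff _).symm

theorem pord_eq_iff {g : GL (Fin 2) F} {n : ℕ} :
    pord g = n ↔ ∀ k : ℕ, IsScal (g ^ k).val ↔ n ∣ k := by
  constructor
  · rintro rfl k
    exact isScal_pow_iff
  · intro h
    exact Nat.dvd_antisymm (isScal_pow_iff.1 ((h n).2 dvd_rfl))
      ((h _).1 (isScal_pow_iff.2 dvd_rfl))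

theorem isScal_iff_pord_eq_one {g : GL (Fin 2) F} : IsScal g.val ↔ pord g = 1 := by
  rw [← Nat.dvd_one, ← isScal_pow_iff, pow_one]

theorem pord_conj (c g : GL (Fin 2) F) : pord (c * g * c⁻¹) = pord g := by
  rw [pord_eq_iff]
  intro k
  rw [conj_pow, ← isScal_pow_iff, isScal_iff_mem_center, isScal_iff_mem_center]
  constructor
  · intro h
    have := (Subgroup.instNormalCenter (G := GL (Fin 2) F)).conj_mem _ h c⁻¹
    simpa [mul_assoc] using this
  · intro h
    exact (Subgroup.instNormalCenter (G := GL (Fin 2) F)).conj_mem _ h c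

/-- No element of `G` is a non-trivial unipotent element times a scalar. -/
def NoUnip (G : Subgroup (GL (Fin 2) F)) : Prop :=
  ∀ g ∈ G, g.val.trace ^ 2 = 4 * g.val.det → IsScal g.val

theorem trace_conj (c g : GL (Fin 2) F) : (c * g * c⁻¹).val.trace = g.val.trace := by
  rw [Units.val_mul, Units.val_mul, Matrix.trace_mul_comm, ← mul_assoc, ← Units.val_mul,
    inv_mul_cancel, Units.val_one, one_mul]

theorem det_conj (c g : GL (Fin 2) F) : (c * g * c⁻¹).val.det = g.val.det := by
  rw [Units.val_mul, Units.val_mul, Matrix.det_mul_comm, ← mul_assoc, ← Units.val_mul,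
    inv_mul_cancel, Units.val_one, one_mul]

theorem det_val_ne_zero (g : GL (Fin 2) F) : g.val.det ≠ 0 :=
  ((Matrix.isUnit_iff_isUnit_det _).1 g.isUnit).ne_zero

theorem det_commutator (x y : GL (Fin 2) F) : (x * y * x⁻¹ * y⁻¹).val.det = 1 := by
  have hx := det_val_ne_zero x
  have hy := det_val_ne_zero y
  have h : (x * y * x⁻¹ * y⁻¹).val.det * (x.val.det * y.val.det) = x.val.det * y.val.det := by
    rw [mul_comm x.val.det, ← Matrix.det_mul, ← Matrix.det_mul, ← Units.val_mul, ← Units.val_mul,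
      show x * y * x⁻¹ * y⁻¹ * (y * x) = x * y by group, Units.val_mul, Units.val_mul,
      Matrix.det_mul, Matrix.det_mul, mul_comm]
  exact mul_right_cancel₀ (mul_ne_zero hx hy) (by rw [h, one_mul])

theorem NoUnip.trace_commutator_ne_two {G : Subgroup (GL (Fin 2) F)} (hG : NoUnip G)
    {x y : GL (Fin 2) F} (hx : x ∈ G) (hy : y ∈ G) (hxy : x * y ≠ y * x) :
    (x * y * x⁻¹ * y⁻¹).val.trace ≠ 2 := by
  intro ht
  have hmem : x * y * x⁻¹ * y⁻¹ ∈ G :=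
    G.mul_mem (G.mul_mem (G.mul_mem hx hy) (G.inv_mem hx)) (G.inv_mem hy)
  have hs := hG _ hmem (by rw [ht, det_commutator]; norm_num)
  obtain ⟨a, ha⟩ := isScal_iff.1 hs
  have hd := det_commutator x y
  rw [ha] at hd ht
  simp at ht hd
  have ha1 : a = 1 := by
    rcases hd with hd | hd
    · exact hd
    · have h0 : (a - 1) ^ 2 = 0 := by linear_combination (a - 1) * hd - ht
      exact sub_eq_zero.1 (by simpa using h0)
  have h1 : x * y * x⁻¹ * y⁻¹ = 1 := Units.ext (by rw [ha, ha1]; simp)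
  apply hxy
  calc x * y = x * y * x⁻¹ * y⁻¹ * (y * x) := by group
    _ = y * x := by rw [h1, one_mul]

theorem NoUnip.det_commutator_ne_zero {G : Subgroup (GL (Fin 2) F)} (hG : NoUnip G)
    {x y : GL (Fin 2) F} (hx : x ∈ G) (hy : y ∈ G) (hxy : x * y ≠ y * x) :
    (x.val * y.val - y.val * x.val).det ≠ 0 := by
  intro h0
  apply hG.trace_commutator_ne_two hx hy hxy
  have h1 : x.val * y.val - y.val * x.val
      = ((x * y * x⁻¹ * y⁻¹).val - 1) * (y.val * x.val) := by
    rw [sub_mul, one_mul, ← Units.val_mul, ← Units.val_mul, ← Units.val_mul]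
    congr 2
    group
  rw [h1, Matrix.det_mul, Matrix.det_mul] at h0
  have h2 := (mul_eq_zero.1 h0).resolve_right
    (mul_ne_zero (det_val_ne_zero y) (det_val_ne_zero x))
  have h3 := det_commutator x y
  generalize (x * y * x⁻¹ * y⁻¹).val = C at h2 h3
  simp [Matrix.trace_fin_two, Matrix.det_fin_two] at h2 h3 ⊢
  linear_combination h3 - h2

end ProjectiveOrder

section Idempotents

variable {K : Type*} [Field K]

/-- A projection of rank one. -/
def IsProj (e : Matrix (Fin 2) (Fin 2) K) : Prop := e * e = e ∧ e.trace = 1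

variable {e : Matrix (Fin 2) (Fin 2) K}

theorem IsProj.not_isScal (he : IsProj e) : ¬ IsScal e := by
  intro h
  obtain ⟨a, rfl⟩ := isScal_iff.1 h
  obtain ⟨h1, h2⟩ := he
  have h1 : a * a = a := by simpa using congrFun (congrFun h1 0) 0
  simp at h2
  have h3 : a = 0 := by linear_combination a * h2 - 2 * h1
  simp [h3] at h2

theorem IsProj.det_eq_zero (he : IsProj e) : e.det = 0 := by
  have h := sq_eq e
  rw [he.1, he.2, one_smul] at h
  have h := congrFun (congrFun h 0) 0
  simp at h
  linear_combination h

theorem IsProj.one_sub (he : IsProj e) : IsProj (1 - e) := by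
  refine ⟨?_, ?_⟩
  · rw [mul_sub, sub_mul, sub_mul, he.1]; simp
  · rw [Matrix.trace_sub, he.2]; simp; norm_num

theorem IsProj.ne_one_sub (he : IsProj e) : e ≠ 1 - e := by
  intro h
  have h1 : e * e = 0 := by
    nth_rewrite 2 [h]
    rw [mul_sub, he.1]; simp
  have h2 := he.2
  rw [← he.1, h1] at h2
  simp at h2

theorem IsProj.eq_add_smul (he : IsProj e) {B : Matrix (Fin 2) (Fin 2) K} (h : B * e = e * B) :
    B = (B.trace - (B * e).trace) • 1 + ((B * e).trace - (B.trace - (B * e).trace)) • e := by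
  obtain ⟨a, b, rfl⟩ := exists_eq_of_commute he.not_isScal h
  have h1 : ((a • (1 : Matrix (Fin 2) (Fin 2) K) + b • e) * e).trace = a + b := by
    simp [add_mul, he.1, he.2]
  have h2 : (a • (1 : Matrix (Fin 2) (Fin 2) K) + b • e).trace = 2 * a + b := by
    simp [he.2]; ring
  rw [h1, h2]
  congr 2 <;> ring

theorem det_smul_one_add_smul (a b : K) (A : Matrix (Fin 2) (Fin 2) K) :
    (a • 1 + b • A).det = a ^ 2 + a * b * A.trace + b ^ 2 * A.det := by
  simp [Matrix.trace_fin_two, Matrix.det_fin_two]; ring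

theorem IsProj.det_eq (he : IsProj e) {B : Matrix (Fin 2) (Fin 2) K} (h : B * e = e * B) :
    B.det = (B * e).trace * (B.trace - (B * e).trace) := by
  conv_lhs => rw [he.eq_add_smul h]
  rw [det_smul_one_add_smul, he.2, he.det_eq_zero]
  ring

theorem IsProj.trace_mul (he : IsProj e) {A B : Matrix (Fin 2) (Fin 2) K}
    (hA : A * e = e * A) (hB : B * e = e * B) :
    (A * B * e).trace = (A * e).trace * (B * e).trace ∧
    (A * B).trace - (A * B * e).trace =
      (A.trace - (A * e).trace) * (B.trace - (B * e).trace) := by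
  obtain ⟨a, b, rfl⟩ := exists_eq_of_commute he.not_isScal hA
  obtain ⟨c, d, rfl⟩ := exists_eq_of_commute he.not_isScal hB
  constructor <;> simp [add_mul, mul_add, he.1, he.2] <;> ring

theorem IsProj.eq_or_eq (he : IsProj e) {e' A : Matrix (Fin 2) (Fin 2) K} (he' : IsProj e')
    (hA : ¬ IsScal A) (h : A * e = e * A) (h' : A * e' = e' * A) : e' = e ∨ e' = 1 - e := by
  obtain ⟨a, b, rfl⟩ := exists_eq_of_commute he.not_isScal (commute_trans hA h'.symm h.symm)
  have h2 : 2 * a + b = 1 := by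
    have := he'.2
    simp [he.2] at this
    linear_combination this
  have h1 : a * (a + b) = 0 := by
    have := he'.det_eq_zero
    rw [det_smul_one_add_smul, he.2, he.det_eq_zero] at this
    linear_combination this
  rcases mul_eq_zero.1 h1 with rfl | h1
  · left
    have : b = 1 := by linear_combination h2
    simp [this]
  · right
    have ha : a = 1 := by linear_combination h2 - h1
    have hb : b = -1 := by linear_combination h1 - ha
    rw [ha, hb]; simp [sub_eq_add_neg]

theorem exists_isProj [IsAlgClosed K] {A : Matrix (Fin 2) (Fin 2) K}
    (hA : A.trace ^ 2 ≠ 4 * A.det) : ∃ e, IsProj e ∧ A * e = e * A := by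
  obtain ⟨x, hx⟩ := IsAlgClosed.exists_root (Polynomial.X ^ 2 - Polynomial.C A.trace * Polynomial.X
    + Polynomial.C A.det) (by
      have : (Polynomial.X ^ 2 - Polynomial.C A.trace * Polynomial.X
        + Polynomial.C A.det).degree = 2 := by compute_degree!
      rw [this]; norm_num)
  simp at hx
  have hne : 2 * x - A.trace ≠ 0 := by
    intro h
    apply hA
    linear_combination -4 * hx + (2 * x - A.trace) * h
  refine ⟨(2 * x - A.trace)⁻¹ • (A - (A.trace - x) • 1), ⟨?_, ?_⟩, ?_⟩
  · have h1 : (A - (A.trace - x) • 1) * (A - (A.trace - x) • 1)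
        = (2 * x - A.trace) • (A - (A.trace - x) • (1 : Matrix (Fin 2) (Fin 2) K)) := by
      have h2 : A.det = A.trace * x - x ^ 2 := by linear_combination hx
      rw [sub_mul, mul_sub, sq_eq, h2]
      simp only [smul_mul_assoc, one_mul, mul_smul_comm, mul_one]
      module
    rw [smul_mul_smul_comm, h1, smul_smul, mul_assoc, inv_mul_cancel₀ hne, mul_one]
  · simp
    field_simp
    ring
  · simp [mul_sub, sub_mul]

end Idempotents

section BaseChange

variable {F : Type*} [Field F] (K : Type*) [Field K] [Algebra F K]

/-- The matrix of an element of `GL₂(F)`, seen over an extension `K` of `F`. -/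
def baseMat : GL (Fin 2) F →* Matrix (Fin 2) (Fin 2) K :=
  (algebraMap F K).mapMatrix.toMonoidHom.comp (Units.coeHom _)

theorem baseMat_apply (g : GL (Fin 2) F) (i j : Fin 2) :
    baseMat K g i j = algebraMap F K (g.val i j) := rfl

theorem trace_baseMat (g : GL (Fin 2) F) :
    (baseMat K g).trace = algebraMap F K g.val.trace := by
  simp [Matrix.trace_fin_two, baseMat_apply]

theorem det_baseMat (g : GL (Fin 2) F) :
    (baseMat K g).det = algebraMap F K g.val.det := by
  simp [Matrix.det_fin_two, baseMat_apply]

theorem isScal_baseMat {g : GL (Fin 2) F} : IsScal (baseMat K g) ↔ IsScal g.val := by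
  simp [IsScal, baseMat_apply]

theorem baseMat_injective : Function.Injective (baseMat (F := F) K) := by
  intro g h hgh
  apply Units.ext
  ext i j
  have := congrFun (congrFun hgh i) j
  rw [baseMat_apply, baseMat_apply] at this
  exact (algebraMap F K).injective this

theorem baseMat_mul_inv (g : GL (Fin 2) F) : baseMat K g * baseMat K g⁻¹ = 1 := by
  rw [← map_mul, mul_inv_cancel, map_one]

theorem baseMat_inv_mul (g : GL (Fin 2) F) : baseMat K g⁻¹ * baseMat K g = 1 := by
  rw [← map_mul, inv_mul_cancel, map_one]

theorem baseMat_conj_eq_iff (g : GL (Fin 2) F) (e : Matrix (Fin 2) (Fin 2) K) :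
    baseMat K g * e * baseMat K g⁻¹ = e ↔ baseMat K g * e = e * baseMat K g := by
  constructor
  · intro h
    nth_rewrite 2 [← h]
    rw [mul_assoc, baseMat_inv_mul, mul_one]
  · intro h
    rw [h, mul_assoc, baseMat_mul_inv, mul_one]

theorem baseMat_conj_commute {g x : GL (Fin 2) F} {e : Matrix (Fin 2) (Fin 2) K}
    (h : baseMat K x * e = e * baseMat K x) :
    baseMat K (g * x * g⁻¹) * (baseMat K g * e * baseMat K g⁻¹) =
      baseMat K g * e * baseMat K g⁻¹ * baseMat K (g * x * g⁻¹) := by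
  have h1 := baseMat_inv_mul K g
  simp only [map_mul, mul_assoc]
  rw [← mul_assoc (baseMat K g⁻¹) (baseMat K g), h1, one_mul,
    ← mul_assoc (baseMat K g⁻¹) (baseMat K g), h1, one_mul,
    ← mul_assoc (baseMat K x), h, mul_assoc]

theorem IsProj.conj {e : Matrix (Fin 2) (Fin 2) K} (he : IsProj e) (g : GL (Fin 2) F) :
    IsProj (baseMat K g * e * baseMat K g⁻¹) := by
  have h1 := baseMat_inv_mul K g
  constructor
  · simp only [mul_assoc]
    rw [← mul_assoc (baseMat K g⁻¹) (baseMat K g), h1, one_mul, ← mul_assoc e, he.1]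
  · rw [Matrix.trace_mul_comm, ← mul_assoc, h1, one_mul, he.2]

variable (G : Subgroup (GL (Fin 2) F))

/-- The rank one projections over `K` which commute with some non-scalar element of `G`. -/
def IsFixedProj (e : Matrix (Fin 2) (Fin 2) K) : Prop :=
  IsProj e ∧ ∃ g ∈ G, ¬ IsScal g.val ∧ baseMat K g * e = e * baseMat K g

variable {G} in
theorem IsFixedProj.conj {e : Matrix (Fin 2) (Fin 2) K} (he : IsFixedProj K G e)
    {g : GL (Fin 2) F} (hg : g ∈ G) : IsFixedProj K G (baseMat K g * e * baseMat K g⁻¹) := by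
  obtain ⟨hp, x, hx, hxs, hxe⟩ := he
  refine ⟨hp.conj K g, g * x * g⁻¹, G.mul_mem (G.mul_mem hg hx) (G.inv_mem hg), ?_,
    baseMat_conj_commute K hxe⟩
  rwa [isScal_iff_pord_eq_one, pord_conj, ← isScal_iff_pord_eq_one]

/-- The type of rank one projections over `K` commuting with some non-scalar element of `G`. -/
structure FixedProj where
  /-- The underlying matrix. -/
  val : Matrix (Fin 2) (Fin 2) K
  /-- The defining property. -/
  isFixedProj : IsFixedProj K G val

variable {K} {G}

theorem FixedProj.ext {e e' : FixedProj K G} (h : e.val = e'.val) : e = e' := by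
  cases e; cases e'; cases h; rfl

theorem FixedProj.isProj (e : FixedProj K G) : IsProj e.val := e.isFixedProj.1

instance : MulAction G (FixedProj K G) where
  smul g e := ⟨baseMat K g.val * e.val * baseMat K g.val⁻¹, e.isFixedProj.conj K g.property⟩
  one_smul e := FixedProj.ext (by
    change baseMat K 1 * e.val * baseMat K 1⁻¹ = e.val
    simp)
  mul_smul g h e := FixedProj.ext (by
    change baseMat K (g.val * h.val) * e.val * baseMat K (g.val * h.val)⁻¹
      = baseMat K g.val * (baseMat K h.val * e.val * baseMat K h.val⁻¹) * baseMat K g.val⁻¹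
    simp only [_root_.mul_inv_rev, map_mul, mul_assoc])

theorem FixedProj.mem_stabilizer {g : G} {e : FixedProj K G} :
    g ∈ MulAction.stabilizer G e ↔ baseMat K g.val * e.val = e.val * baseMat K g.val := by
  rw [MulAction.mem_stabilizer_iff, ← baseMat_conj_eq_iff]
  exact ⟨fun h => congrArg FixedProj.val h, fun h => FixedProj.ext h⟩

theorem FixedProj.mem_stabilizer_of_isScal {g : G} {e : FixedProj K G}
    (h : IsScal (g : GL (Fin 2) F).val) : g ∈ MulAction.stabilizer G e := by
  rw [mem_stabilizer]
  exact ((isScal_baseMat K).2 h).commute _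

/-- The ratio of the eigenvalues of an element commuting with a rank one projection. -/
def FixedProj.ratio (e : FixedProj K G) : MulAction.stabilizer G e →* K where
  toFun g := (baseMat K (g : GL (Fin 2) F) * e.val).trace /
    ((baseMat K (g : GL (Fin 2) F)).trace - (baseMat K (g : GL (Fin 2) F) * e.val).trace)
  map_one' := by
    have := e.isProj.2
    simp [this]
    norm_num
  map_mul' g h := by
    obtain ⟨h1, h2⟩ := e.isProj.trace_mul (mem_stabilizer.1 g.2) (mem_stabilizer.1 h.2)
    have h3 : baseMat K ((g * h : MulAction.stabilizer G e) : GL (Fin 2) F)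
      = baseMat K (g : GL (Fin 2) F) * baseMat K (h : GL (Fin 2) F) := by
      rw [← map_mul]; rfl
    rw [h3, h2, h1, mul_div_mul_comm]

theorem FixedProj.eigenvalues_ne_zero (e : FixedProj K G) (g : MulAction.stabilizer G e) :
    (baseMat K (g : GL (Fin 2) F) * e.val).trace ≠ 0 ∧
    (baseMat K (g : GL (Fin 2) F)).trace - (baseMat K (g : GL (Fin 2) F) * e.val).trace ≠ 0 := by
  have h := e.isProj.det_eq (mem_stabilizer.1 g.2)
  rw [det_baseMat] at h
  have h0 : algebraMap F K (g : GL (Fin 2) F).val.det ≠ 0 := by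
    simpa using det_val_ne_zero (g : GL (Fin 2) F)
  rw [h] at h0
  exact ⟨left_ne_zero_of_mul h0, right_ne_zero_of_mul h0⟩

theorem FixedProj.ratio_eq_one_iff (e : FixedProj K G) (g : MulAction.stabilizer G e) :
    e.ratio g = 1 ↔ IsScal (g : GL (Fin 2) F).val := by
  have h1 := (e.eigenvalues_ne_zero g).2
  change _ / _ = (1 : K) ↔ _
  rw [div_eq_one_iff_eq h1, ← isScal_baseMat K]
  have h2 := e.isProj.eq_add_smul (mem_stabilizer.1 g.2)
  constructor
  · intro h
    rw [h2, ← h, sub_self, zero_smul, add_zero]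
    exact isScal_iff.2 ⟨_, rfl⟩
  · intro h
    obtain ⟨a, ha⟩ := isScal_iff.1 h
    rw [ha]
    have := e.isProj.2
    simp [this]
    ring

theorem FixedProj.ratio_eq_neg_one_iff (e : FixedProj K G) (g : MulAction.stabilizer G e) :
    e.ratio g = -1 ↔ (g : GL (Fin 2) F).val.trace = 0 := by
  have h1 := (e.eigenvalues_ne_zero g).2
  change _ / _ = (-1 : K) ↔ _
  rw [div_eq_iff h1, ← (algebraMap F K).injective.eq_iff, ← trace_baseMat, map_zero]
  constructor
  · intro h; linear_combination h
  · intro h; linear_combination h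

/-- The order of the image of the stabilizer of `e` in the projective linear group. -/
noncomputable def FixedProj.ord (e : FixedProj K G) : ℕ :=
  Nat.card e.ratio.toHomUnits.range

theorem FixedProj.toHomUnits_eq_one_iff (e : FixedProj K G) (g : MulAction.stabilizer G e) :
    e.ratio.toHomUnits g = 1 ↔ IsScal (g : GL (Fin 2) F).val := by
  rw [← e.ratio_eq_one_iff, Units.ext_iff]
  rfl

/-- The number of scalar elements of `G`. -/
noncomputable def scalCard (G : Subgroup (GL (Fin 2) F)) : ℕ :=
  Nat.card {g : G // IsScal (g : GL (Fin 2) F).val}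

theorem FixedProj.card_ker (e : FixedProj K G) :
    Nat.card e.ratio.toHomUnits.ker = scalCard G := by
  refine Nat.card_congr
    { toFun := fun g => ⟨g.1.1, (e.toHomUnits_eq_one_iff g.1).1 g.2⟩
      invFun := fun g => ⟨⟨g.1, mem_stabilizer_of_isScal g.2⟩,
        (e.toHomUnits_eq_one_iff ⟨g.1, mem_stabilizer_of_isScal g.2⟩).2 g.2⟩
      left_inv := fun g => rfl
      right_inv := fun g => rfl }

theorem FixedProj.card_stabilizer (e : FixedProj K G) :
    Nat.card (MulAction.stabilizer G e) = e.ord * scalCard G := by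
  rw [← Subgroup.card_mul_index e.ratio.toHomUnits.ker, e.card_ker, Subgroup.index_ker, mul_comm]
  rfl

variable [Finite G]

theorem scalCard_pos : 0 < scalCard G := by
  have : Nonempty {g : G // IsScal (g : GL (Fin 2) F).val} := ⟨1, by simp [IsScal]⟩
  exact Nat.card_pos

theorem FixedProj.exists_generator (e : FixedProj K G) :
    ∃ u : MulAction.stabilizer G e, pord (u : GL (Fin 2) F) = e.ord ∧
      ∀ g : MulAction.stabilizer G e, ∃ i : ℕ,
        IsScal ((g : GL (Fin 2) F)⁻¹ * (u : GL (Fin 2) F) ^ i).val := by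
  have : Finite e.ratio.toHomUnits.range :=
    Set.Finite.to_subtype (Set.finite_range e.ratio.toHomUnits)
  obtain ⟨x, hx⟩ := IsCyclic.exists_monoid_generator (α := e.ratio.toHomUnits.range)
  obtain ⟨u, hu⟩ := x.2
  refine ⟨u, ?_, fun g => ?_⟩
  · rw [pord_eq_iff]
    intro k
    have h := e.toHomUnits_eq_one_iff (u ^ k)
    have h1 : (((u ^ k : MulAction.stabilizer G e) : G) : GL (Fin 2) F)
      = ((u : G) : GL (Fin 2) F) ^ k := rfl
    rw [h1, map_pow, ← orderOf_dvd_iff_pow_eq_one] at h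
    rw [← h, FixedProj.ord, hu, Subgroup.orderOf_coe,
      orderOf_eq_card_of_forall_mem_zpowers fun y => by
        obtain ⟨i, hi⟩ := hx y
        exact ⟨i, by simpa using hi⟩]
  · obtain ⟨i, hi⟩ := hx ⟨_, g, rfl⟩
    refine ⟨i, ?_⟩
    have h := e.toHomUnits_eq_one_iff (g⁻¹ * u ^ i)
    have h1 : (((g⁻¹ * u ^ i : MulAction.stabilizer G e) : G) : GL (Fin 2) F)
      = ((g : G) : GL (Fin 2) F)⁻¹ * ((u : G) : GL (Fin 2) F) ^ i := rfl
    rw [h1] at h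
    rw [← h, map_mul, map_inv, map_pow, inv_mul_eq_one, hu]
    exact (congrArg Subtype.val hi).symm

theorem FixedProj.card_trace_zero (e : FixedProj K G) (h2 : (2 : F) ≠ 0) :
    Nat.card {g : MulAction.stabilizer G e // (g : GL (Fin 2) F).val.trace = 0} =
      if Even e.ord then scalCard G else 0 := by
  have : Finite e.ratio.toHomUnits.range :=
    Set.Finite.to_subtype (Set.finite_range e.ratio.toHomUnits)
  have h2' : (2 : K) ≠ 0 := by
    intro h
    apply h2
    apply (algebraMap F K).injective
    rw [map_ofNat, map_zero, h]
  have hneg : (-1 : Kˣ) ≠ 1 := by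
    intro h
    have := congrArg Units.val h
    simp at this
    apply h2'
    linear_combination -this
  have htr : ∀ g : MulAction.stabilizer G e,
      e.ratio.toHomUnits g = -1 ↔ (g : GL (Fin 2) F).val.trace = 0 := by
    intro g
    rw [← e.ratio_eq_neg_one_iff, Units.ext_iff]
    rfl
  split_ifs with hev
  · obtain ⟨x, hw⟩ := exists_prime_orderOf_dvd_card' 2 hev.two_dvd
    obtain ⟨w, hx⟩ := x.2
    rw [← Subgroup.orderOf_coe, ← hx] at hw
    have hw1 : e.ratio.toHomUnits w = -1 := by
      obtain ⟨h3, h4⟩ := orderOf_eq_prime_iff.1 hw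
      have h5 : ((e.ratio.toHomUnits w : Kˣ) : K) ^ 2 = 1 := by
        rw [← Units.val_pow_eq_pow_val, h3, Units.val_one]
      rcases sq_eq_one_iff.1 h5 with h6 | h6
      · exact absurd (Units.ext h6) h4
      · exact Units.ext h6
    rw [← e.card_ker]
    refine Nat.card_congr
      { toFun := fun g => ⟨w⁻¹ * g.1, ?_⟩
        invFun := fun g => ⟨w * g.1, ?_⟩
        left_inv := fun g => by simp
        right_inv := fun g => by simp }
    · rw [MonoidHom.mem_ker, map_mul, map_inv, hw1, (htr g.1).2 g.2]; simp
    · rw [← htr, map_mul, hw1, MonoidHom.mem_ker.1 g.2, mul_one]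
  · rw [Nat.card_eq_zero]
    left
    refine ⟨fun g => hev ?_⟩
    rw [even_iff_two_dvd]
    have h3 := (htr g.1).2 g.2
    have h4 : orderOf (⟨_, g.1, rfl⟩ : e.ratio.toHomUnits.range) = 2 := by
      rw [← Subgroup.orderOf_coe]
      change orderOf (e.ratio.toHomUnits g.1) = 2
      rw [h3]
      exact orderOf_eq_prime (by simp) hneg
    rw [← h4]
    exact orderOf_dvd_natCard _

end BaseChange

section Orbits

variable {F : Type*} [Field F] {K : Type*} [Field K] [Algebra F K] {G : Subgroup (GL (Fin 2) F)}

theorem FixedProj.exists_mem_stabilizer (e : FixedProj K G) :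
    ∃ g : G, ¬ IsScal g.val.val ∧ g ∈ MulAction.stabilizer G e := by
  obtain ⟨g, hg, hgs, hge⟩ := e.isFixedProj.2
  exact ⟨⟨g, hg⟩, hgs, FixedProj.mem_stabilizer.2 hge⟩

theorem FixedProj.card_fixed [IsAlgClosed K] (hG : NoUnip G) {g : G} (hg : ¬ IsScal g.val.val) :
    Nat.card {e : FixedProj K G // g • e = e} = 2 := by
  have hg' : ¬ IsScal (baseMat K g.val) := by rwa [isScal_baseMat]
  obtain ⟨e, he, hge⟩ := exists_isProj (A := baseMat K g.val) (by
    intro h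
    rw [trace_baseMat, det_baseMat] at h
    exact hg (hG _ g.2 ((algebraMap F K).injective (by
      rw [map_pow, map_mul, map_ofNat, h]))))
  have hge1 : baseMat K g.val * (1 - e) = (1 - e) * baseMat K g.val := by
    rw [mul_sub, sub_mul, hge, mul_one, one_mul]
  rw [Nat.card_eq_two_iff]
  refine ⟨⟨⟨e, he, g, g.2, hg, hge⟩, FixedProj.mem_stabilizer.2 hge⟩,
    ⟨⟨1 - e, he.one_sub, g, g.2, hg, hge1⟩, FixedProj.mem_stabilizer.2 hge1⟩, ?_, ?_⟩
  · intro h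
    exact he.ne_one_sub (congrArg (fun x => x.1.val) h)
  · refine Set.eq_univ_of_forall fun x => ?_
    rcases he.eq_or_eq x.1.isProj hg' hge (FixedProj.mem_stabilizer.1 x.2) with h | h
    · exact Or.inl (Subtype.ext (FixedProj.ext h))
    · exact Or.inr (Subtype.ext (FixedProj.ext h))

theorem FixedProj.finite [IsAlgClosed K] [Finite G] (hG : NoUnip G) : Finite (FixedProj K G) := by
  have h : (⋃ g : {g : G // ¬ IsScal g.val.val}, {e : FixedProj K G | g.val • e = e}).Finite :=
    Set.finite_iUnion fun g =>
      Set.finite_coe_iff.1 (Nat.finite_of_card_ne_zero (by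
        change Nat.card {e : FixedProj K G // g.val • e = e} ≠ 0
        rw [FixedProj.card_fixed hG g.2]; norm_num))
  refine Set.finite_univ_iff.1 (h.subset fun e _ => ?_)
  obtain ⟨g, hg, hge⟩ := e.exists_mem_stabilizer
  exact Set.mem_iUnion.2 ⟨⟨g, hg⟩, hge⟩

theorem FixedProj.double_count [IsAlgClosed K] [Finite G] [Fintype (FixedProj K G)]
    (hG : NoUnip G) (P : G → Prop) (hP : ∀ g, P g → ¬ IsScal g.val.val) :
    2 * Nat.card {g : G // P g} =
      ∑ e : FixedProj K G, Nat.card {g : MulAction.stabilizer G e // P g.val} := by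
  classical
  have := Fintype.ofFinite G
  have h := Finset.sum_card_bipartiteAbove_eq_sum_card_bipartiteBelow
    (fun (g : G) (e : FixedProj K G) => g • e = e) (s := Finset.univ.filter P) (t := Finset.univ)
  have h1 : ∀ g ∈ Finset.univ.filter P, (Finset.univ.bipartiteAbove
      (fun (g : G) (e : FixedProj K G) => g • e = e) g).card = 2 := by
    intro g hg
    have h2 := FixedProj.card_fixed (K := K) hG (hP g (Finset.mem_filter.1 hg).2)
    rwa [Nat.card_eq_fintype_card, Fintype.card_subtype] at h2
  rw [Finset.sum_congr rfl h1, Finset.sum_const, smul_eq_mul, mul_comm] at h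
  rw [Nat.card_eq_fintype_card, Fintype.card_subtype, h]
  refine Finset.sum_congr rfl fun e _ => ?_
  rw [Finset.bipartiteBelow, Finset.filter_filter, ← Fintype.card_subtype,
    ← Nat.card_eq_fintype_card]
  exact Nat.card_congr
    { toFun := fun g => ⟨⟨g.1, g.2.2⟩, g.2.1⟩
      invFun := fun g => ⟨g.1.1, g.2, g.1.2⟩
      left_inv := fun _ => rfl
      right_inv := fun _ => rfl }

theorem FixedProj.card_orbit [Finite G] (e : FixedProj K G) :
    Nat.card (MulAction.orbit G e) * (e.ord * scalCard G) = Nat.card G := by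
  rw [← e.card_stabilizer, mul_comm, Nat.card_congr (MulAction.orbitEquivQuotientStabilizer G e)]
  exact Subgroup.card_mul_index _

theorem FixedProj.ord_eq_of_mem_orbit [Finite G] {e e' : FixedProj K G}
    (h : e ∈ MulAction.orbit G e') : e.ord = e'.ord := by
  have h1 := e.card_orbit
  rw [MulAction.orbit_eq_iff.2 h, ← e'.card_orbit] at h1
  have h2 : 0 < Nat.card (MulAction.orbit G e') := by
    have : Finite (MulAction.orbit G e') := Set.finite_range _ |>.to_subtype
    have : Nonempty (MulAction.orbit G e') := ⟨⟨e', MulAction.mem_orbit_self e'⟩⟩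
    exact Nat.card_pos
  exact Nat.eq_of_mul_eq_mul_right scalCard_pos (Nat.eq_of_mul_eq_mul_left h2 h1)

theorem FixedProj.sum_eq_sum_orbits [Finite G] [Fintype (FixedProj K G)]
    [Fintype (MulAction.orbitRel.Quotient G (FixedProj K G))] (f : ℕ → ℚ) :
    ∑ e : FixedProj K G, f e.ord =
      ∑ ω : MulAction.orbitRel.Quotient G (FixedProj K G),
        Nat.card (MulAction.orbit G ω.out) * f ω.out.ord := by
  classical
  rw [← (MulAction.selfEquivSigmaOrbits G (FixedProj K G)).symm.sum_comp, Fintype.sum_sigma]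
  refine Finset.sum_congr rfl fun ω _ => ?_
  rw [Nat.card_eq_fintype_card, ← nsmul_eq_mul, ← Finset.card_univ]
  refine Finset.sum_eq_card_nsmul fun e _ => ?_
  rw [← FixedProj.ord_eq_of_mem_orbit e.2]
  rfl

theorem FixedProj.two_le_ord [Finite G] (e : FixedProj K G) : 2 ≤ e.ord := by
  obtain ⟨u, hu, hgen⟩ := e.exists_generator
  obtain ⟨g, hg, hge⟩ := e.exists_mem_stabilizer
  have h0 : e.ord ≠ 0 := by
    intro h
    have h1 := e.card_orbit
    rw [h, zero_mul, mul_zero] at h1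
    exact Nat.card_pos.ne h1
  have h1 : e.ord ≠ 1 := by
    intro h
    rw [h, ← isScal_iff_pord_eq_one] at hu
    obtain ⟨i, hi⟩ := hgen ⟨g, hge⟩
    apply hg
    have h2 : g.val = u.val.val ^ i * (g.val⁻¹ * u.val.val ^ i)⁻¹ := by group
    rw [isScal_iff_mem_center] at *
    rw [h2]
    exact Subgroup.mul_mem _ (Subgroup.pow_mem _ hu _) (Subgroup.inv_mem _ hi)
  omega

end Orbits

section Arithmetic

theorem classEq_three {a b c N : ℕ} (ha : 2 ≤ a) (hab : a ≤ b) (hbc : b ≤ c) (hN : 0 < N)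
    (h : (1 - 1 / a + (1 - 1 / b) + (1 - 1 / c) : ℚ) = 2 - 2 / N) :
    (a = 2 ∧ b = 2 ∧ N = 2 * c) ∨
      (a = 2 ∧ b = 3 ∧ (c = 3 ∧ N = 12 ∨ c = 4 ∧ N = 24 ∨ c = 5 ∧ N = 60)) := by
  have hb : 2 ≤ b := ha.trans hab
  have hc : 2 ≤ c := hb.trans hbc
  have hN' : (0 : ℚ) < N := by exact_mod_cast hN
  have hNi : (0 : ℚ) < 2 / N := by positivity
  have ha2 : a = 2 := by
    by_contra hne
    have h3 : ∀ k : ℕ, 3 ≤ k → (1 / k : ℚ) ≤ 1 / 3 := fun k hk =>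
      one_div_le_one_div_of_le (by norm_num) (by exact_mod_cast hk)
    have := h3 a (by omega)
    have := h3 b (by omega)
    have := h3 c (by omega)
    linarith
  subst ha2
  have hb3 : b ≤ 3 := by
    by_contra hne
    have h4 : ∀ k : ℕ, 4 ≤ k → (1 / k : ℚ) ≤ 1 / 4 := fun k hk =>
      one_div_le_one_div_of_le (by norm_num) (by exact_mod_cast hk)
    have := h4 b (by omega)
    have := h4 c (by omega)
    push_cast at h
    linarith
  have hc' : (c : ℚ) ≠ 0 := by positivity
  interval_cases b
  · left
    refine ⟨rfl, rfl, ?_⟩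
    push_cast at h
    field_simp at h
    have : (N : ℚ) = 2 * c := by linarith
    exact_mod_cast this
  · right
    refine ⟨rfl, rfl, ?_⟩
    have hc5 : c ≤ 5 := by
      by_contra hne
      have h6 : (1 / c : ℚ) ≤ 1 / 6 :=
        one_div_le_one_div_of_le (by norm_num) (by exact_mod_cast (by omega : 6 ≤ c))
      push_cast at h
      linarith
    interval_cases c
    · left
      refine ⟨rfl, ?_⟩
      push_cast at h
      field_simp at h
      have : (N : ℚ) = 12 := by linarith
      exact_mod_cast this
    · right; left
      refine ⟨rfl, ?_⟩
      push_cast at h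
      field_simp at h
      have : (N : ℚ) = 24 := by linarith
      exact_mod_cast this
    · right; right
      refine ⟨rfl, ?_⟩
      push_cast at h
      field_simp at h
      have : (N : ℚ) = 60 := by linarith
      exact_mod_cast this

theorem classEq_two {a b N : ℕ} (ha : 2 ≤ a) (hb : 2 ≤ b) (haN : a ≤ N) (hbN : b ≤ N)
    (h : (1 - 1 / a + (1 - 1 / b) : ℚ) = 2 - 2 / N) : a = N ∧ b = N := by
  have ha' : (0 : ℚ) < a := by exact_mod_cast (by omega : 0 < a)
  have hb' : (0 : ℚ) < b := by exact_mod_cast (by omega : 0 < b)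
  have h1 : (1 / N : ℚ) ≤ 1 / a := one_div_le_one_div_of_le ha' (by exact_mod_cast haN)
  have h2 : (1 / N : ℚ) ≤ 1 / b := one_div_le_one_div_of_le hb' (by exact_mod_cast hbN)
  have h3 : (2 / N : ℚ) = 1 / N + 1 / N := by ring
  have h4 : (1 / a : ℚ) = 1 / N := by linarith
  have h5 : (1 / b : ℚ) = 1 / N := by linarith
  rw [one_div, one_div, _root_.inv_inj] at h4 h5
  exact ⟨by exact_mod_cast h4, by exact_mod_cast h5⟩

theorem classEq_one {a N : ℕ} (ha : 2 ≤ a) (haN : a ≤ N) :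
    (1 - 1 / a : ℚ) ≠ 2 - 2 / N := by
  intro h
  have ha' : (0 : ℚ) < a := by exact_mod_cast (by omega : 0 < a)
  have h1 : (1 / N : ℚ) ≤ 1 / a := one_div_le_one_div_of_le ha' (by exact_mod_cast haN)
  have h2 : (1 / N : ℚ) ≤ 1 / 2 :=
    one_div_le_one_div_of_le (by norm_num) (by exact_mod_cast ha.trans haN)
  have h3 : (2 / N : ℚ) = 1 / N + 1 / N := by ring
  linarith

theorem card_le_three {Ω : Type*} [Fintype Ω] {n : Ω → ℕ} (hn : ∀ ω, 2 ≤ n ω) {N : ℕ}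
    (hN : 0 < N) (h : (∑ ω, (1 - 1 / n ω) : ℚ) = 2 - 2 / N) : Fintype.card Ω < 4 := by
  have h1 : ∑ _ω : Ω, (1 / 2 : ℚ) ≤ ∑ ω, (1 - 1 / n ω : ℚ) := by
    refine Finset.sum_le_sum fun ω _ => ?_
    have : (1 / n ω : ℚ) ≤ 1 / 2 :=
      one_div_le_one_div_of_le (by norm_num) (by exact_mod_cast hn ω)
    linarith
  rw [Finset.sum_const, h, nsmul_eq_mul, Finset.card_univ] at h1
  have h2 : (0 : ℚ) < 2 / N := by positivity
  have h3 : (Fintype.card Ω : ℚ) < 4 := by linarith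
  exact_mod_cast h3

theorem exists_sorted_equiv {Ω : Type*} [Fintype Ω] (hΩ : Fintype.card Ω = 3) (n : Ω → ℕ) :
    ∃ e : Fin 3 ≃ Ω, n (e 0) ≤ n (e 1) ∧ n (e 1) ≤ n (e 2) := by
  let σ := Fintype.equivFinOfCardEq hΩ
  have h := Tuple.monotone_sort (n ∘ σ.symm)
  exact ⟨(Tuple.sort (n ∘ σ.symm)).trans σ.symm, h (by decide), h (by decide)⟩

end Arithmetic

section Classification

variable {F : Type*} [Field F] {G : Subgroup (GL (Fin 2) F)}

/-- `u` generates, modulo scalars, its centralizer in `G`, which has order `n` modulo scalars. -/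
structure IsAxis (G : Subgroup (GL (Fin 2) F)) (n : ℕ) (u : GL (Fin 2) F) : Prop where
  mem : u ∈ G
  not_isScal : ¬ IsScal u.val
  pord_eq : pord u = n
  card_eq : Nat.card {g : G // g.val * u = u * g.val} = n * scalCard G
  exists_pow : ∀ g ∈ G, g * u = u * g → ∃ i : ℕ, IsScal (g⁻¹ * u ^ i).val

/-- The number of elements of trace zero in `G`. -/
noncomputable def traceZeroCard (G : Subgroup (GL (Fin 2) F)) : ℕ :=
  Nat.card {g : G // g.val.val.trace = 0}

variable {K : Type*} [Field K] [Algebra F K]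

theorem mul_eq_mul_iff_val {x y : GL (Fin 2) F} : x * y = y * x ↔
    x.val * y.val = y.val * x.val := by
  rw [Units.ext_iff, Units.val_mul, Units.val_mul]

theorem GL_commute_trans {x y z : GL (Fin 2) F} (hx : ¬ IsScal x.val) (hy : y * x = x * y)
    (hz : z * x = x * z) : y * z = z * y := by
  rw [mul_eq_mul_iff_val] at *
  exact commute_trans hx hy hz

theorem commute_of_isScal_inv_mul_pow {g u : GL (Fin 2) F} {i : ℕ}
    (h : IsScal (g⁻¹ * u ^ i).val) : g * u = u * g := by
  have h1 : Commute (g⁻¹ * u ^ i) u := mul_eq_mul_iff_val.2 (h.commute u.val)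
  have h2 : g = u ^ i * (g⁻¹ * u ^ i)⁻¹ := by group
  rw [h2]
  exact ((Commute.refl u).pow_left i).mul_left h1.inv_left

theorem FixedProj.commute_iff (e : FixedProj K G) {u g : G} (hu : ¬ IsScal u.val.val)
    (hue : u ∈ MulAction.stabilizer G e) :
    g.val * u.val = u.val * g.val ↔ g ∈ MulAction.stabilizer G e := by
  rw [← (baseMat_injective (F := F) K).eq_iff, map_mul, map_mul, FixedProj.mem_stabilizer]
  rw [FixedProj.mem_stabilizer] at hue
  have hu' : ¬ IsScal (baseMat K u.val) := by rwa [isScal_baseMat]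
  constructor
  · intro h
    exact commute_trans hu' h hue.symm
  · intro h
    exact commute_trans e.isProj.not_isScal h hue

theorem FixedProj.exists_isAxis [Finite G] (e : FixedProj K G) :
    ∃ u : G, u ∈ MulAction.stabilizer G e ∧ IsAxis G e.ord u.val := by
  obtain ⟨u, hu, hgen⟩ := e.exists_generator
  have hs : ¬ IsScal u.val.val.val := by
    rw [isScal_iff_pord_eq_one, hu]
    have := e.two_le_ord
    omega
  refine ⟨u.1, u.2, u.1.2, hs, hu, ?_, fun g hg hgu => ?_⟩
  · rw [← e.card_stabilizer]
    exact Nat.card_congr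
      { toFun := fun g => ⟨g.1, (e.commute_iff hs u.2).1 g.2⟩
        invFun := fun g => ⟨g.1, (e.commute_iff hs u.2).2 g.2⟩
        left_inv := fun _ => rfl
        right_inv := fun _ => rfl }
  · exact hgen ⟨⟨g, hg⟩, (e.commute_iff hs u.2).1 hgu⟩

theorem FixedProj.card_not_isScal [Finite G] (e : FixedProj K G) :
    Nat.card {g : MulAction.stabilizer G e // ¬ IsScal g.val.val.val} + scalCard G =
      e.ord * scalCard G := by
  classical
  rw [← e.card_stabilizer, ← e.card_ker, add_comm]
  have h : Nat.card e.ratio.toHomUnits.ker =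
      Nat.card {g : MulAction.stabilizer G e // IsScal g.val.val.val} :=
    Nat.card_congr (Equiv.subtypeEquivRight fun g => e.toHomUnits_eq_one_iff g)
  rw [h, ← Nat.card_sum]
  exact Nat.card_congr (Equiv.sumCompl _)

theorem card_not_isScal [Finite G] :
    Nat.card {g : G // ¬ IsScal g.val.val} + scalCard G = Nat.card G := by
  classical
  rw [scalCard, add_comm, ← Nat.card_sum]
  exact Nat.card_congr (Equiv.sumCompl _)

end Classification

section Classification

variable {F : Type*} [Field F] {G : Subgroup (GL (Fin 2) F)}

/-- The group `G` modulo scalars is cyclic of order `N`. -/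
structure CycType (G : Subgroup (GL (Fin 2) F)) (N : ℕ) : Prop where
  exists_gen : ∃ u ∈ G, pord u = N ∧ ∀ g ∈ G, ∃ i : ℕ, IsScal (g⁻¹ * u ^ i).val
  card_eq : Nat.card G = N * scalCard G
  traceZeroCard_eq : (2 : F) ≠ 0 → traceZeroCard G = if Even N then scalCard G else 0

/-- The group `G` modulo scalars has order `N`, and its non-trivial elements are contained in
maximal cyclic subgroups of orders in `S`. -/
structure AxisType (G : Subgroup (GL (Fin 2) F)) (S : Set ℕ) (N : ℕ) : Prop where
  exists_isAxis : ∀ n ∈ S, ∃ u, IsAxis G n u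
  exists_commute : ∀ g ∈ G, ¬ IsScal g.val → ∃ n ∈ S, ∃ u, IsAxis G n u ∧ g * u = u * g
  card_eq : Nat.card G = N * scalCard G

/-- The group `G` modulo scalars is dihedral of order `2 * m`. -/
structure DihType (G : Subgroup (GL (Fin 2) F)) (m : ℕ) : Prop
    extends AxisType G {2, m} (2 * m) where
  two_le : 2 ≤ m
  traceZeroCard_eq : (2 : F) ≠ 0 →
    traceZeroCard G = (m + if Even m then 1 else 0) * scalCard G

/-- The group `G` modulo scalars is tetrahedral, octahedral or icosahedral. -/
structure ExcType (G : Subgroup (GL (Fin 2) F)) (n N c : ℕ) : Prop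
    extends AxisType G {2, 3, n} N where
  values : n = 3 ∧ N = 12 ∧ c = 3 ∨ n = 4 ∧ N = 24 ∧ c = 9 ∨ n = 5 ∧ N = 60 ∧ c = 15
  traceZeroCard_eq : (2 : F) ≠ 0 → traceZeroCard G = c * scalCard G

theorem not_isScal_of_trace_eq_zero (h2 : (2 : F) ≠ 0) {g : GL (Fin 2) F}
    (hg : g.val.trace = 0) : ¬ IsScal g.val := by
  rintro ⟨h1, -, h3⟩
  have h4 := det_val_ne_zero g
  rw [Matrix.trace_fin_two, ← h3, ← two_mul] at hg
  have h5 : g.val 0 0 = 0 := (mul_eq_zero.1 hg).resolve_left h2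
  apply h4
  rw [Matrix.det_fin_two, h1, h5]
  ring

theorem classification [Finite G] (hG : NoUnip G) :
    (∃ N, CycType G N) ∨ (∃ m, DihType G m) ∨ ∃ n N c, ExcType G n N c := by
  classical
  let K := AlgebraicClosure F
  have := FixedProj.finite (K := K) hG
  have := Fintype.ofFinite (FixedProj K G)
  let Ω := MulAction.orbitRel.Quotient G (FixedProj K G)
  have : Finite Ω := Quotient.finite _
  have := Fintype.ofFinite Ω
  let n : Ω → ℕ := fun ω => ω.out.ord
  have hs : 0 < scalCard G := scalCard_pos
  have hs' : (scalCard G : ℚ) ≠ 0 := by positivity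
  have hGpos : 0 < Nat.card G := Nat.card_pos
  -- the order of `G` modulo scalars
  obtain ⟨N, hN⟩ : ∃ N, Nat.card G = N * scalCard G := by
    by_cases hE : Nonempty (FixedProj K G)
    · obtain ⟨e⟩ := hE
      exact ⟨_, by rw [← e.card_orbit, ← mul_assoc]⟩
    · have hE' := not_nonempty_iff.1 hE
      have h := FixedProj.double_count (K := K) hG (fun g => ¬ IsScal g.val.val) fun _ h => h
      rw [Finset.univ_eq_empty, Finset.sum_empty] at h
      exact ⟨1, by rw [← card_not_isScal]; omega⟩
  have hNpos : 0 < N := Nat.pos_of_ne_zero fun h => by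
    rw [h, zero_mul] at hN; omega
  have hN' : (N : ℚ) ≠ 0 := by positivity
  have hcq : (Nat.card G : ℚ) = N * scalCard G := by exact_mod_cast hN
  have horb : ∀ e : FixedProj K G, Nat.card (MulAction.orbit G e) * e.ord = N := fun e =>
    Nat.eq_of_mul_eq_mul_right hs (by rw [← hN, ← e.card_orbit, mul_assoc])
  have hn2 : ∀ ω, 2 ≤ n ω := fun ω => ω.out.two_le_ord
  have hnN : ∀ ω, n ω ≤ N := fun ω =>
    Nat.le_of_dvd hNpos ⟨_, by rw [mul_comm]; exact (horb _).symm⟩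
  have horbq : ∀ ω : Ω, (Nat.card (MulAction.orbit G ω.out) : ℚ) = N / n ω := fun ω => by
    rw [eq_div_iff (by have := hn2 ω; positivity)]
    exact_mod_cast horb ω.out
  have hsum : (∑ ω, (1 - 1 / n ω) : ℚ) = 2 - 2 / N := by
    have h := FixedProj.double_count (K := K) hG (fun g => ¬ IsScal g.val.val) fun _ h => h
    have h1 : ∀ e : FixedProj K G,
        (Nat.card {g : MulAction.stabilizer G e // ¬ IsScal g.val.val.val} : ℚ) =
        (fun k : ℕ => ((k : ℚ) - 1) * scalCard G) e.ord := fun e => by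
      have := e.card_not_isScal
      have : (Nat.card {g : MulAction.stabilizer G e // ¬ IsScal g.val.val.val} : ℚ) +
        scalCard G = e.ord * scalCard G := by exact_mod_cast this
      simp only
      linarith
    have h2 : (2 * Nat.card {g : G // ¬ IsScal g.val.val} : ℚ) =
        ∑ e : FixedProj K G,
          (Nat.card {g : MulAction.stabilizer G e // ¬ IsScal g.val.val.val} : ℚ) := by
      exact_mod_cast h
    rw [Finset.sum_congr rfl fun e _ => h1 e,
      FixedProj.sum_eq_sum_orbits fun k : ℕ => ((k : ℚ) - 1) * scalCard G] at h2
    have h3 : (Nat.card {g : G // ¬ IsScal g.val.val} : ℚ) + scalCard G = N * scalCard G := by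
      rw [← hcq]; exact_mod_cast card_not_isScal
    have h4 : ∀ ω : Ω, (Nat.card (MulAction.orbit G ω.out) : ℚ) *
        (((ω.out.ord : ℕ) - 1 : ℚ) * scalCard G) = N * scalCard G * (1 - 1 / n ω) := fun ω => by
      rw [horbq]
      have : (n ω : ℚ) ≠ 0 := by have := hn2 ω; positivity
      change (N / n ω : ℚ) * ((n ω - 1) * scalCard G) = _
      field_simp
    rw [Finset.sum_congr rfl fun e _ => h4 e, ← Finset.mul_sum] at h2
    have h5 : (N * scalCard G : ℚ) ≠ 0 := mul_ne_zero hN' hs'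
    apply mul_left_cancel₀ h5
    rw [← h2]
    field_simp
    linarith
  have htr : (2 : F) ≠ 0 → (2 * traceZeroCard G : ℚ) =
      scalCard G * ∑ ω, (N / n ω * if Even (n ω) then 1 else 0 : ℚ) := fun h2 => by
    have h := FixedProj.double_count (K := K) hG (fun g => g.val.val.trace = 0)
      fun _ h => not_isScal_of_trace_eq_zero h2 h
    rw [Finset.sum_congr rfl fun e _ => e.card_trace_zero h2] at h
    have h3 := FixedProj.sum_eq_sum_orbits (K := K) (G := G)
      (fun k => if Even k then (scalCard G : ℚ) else 0)
    have h4 : (2 * traceZeroCard G : ℚ) =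
      ∑ e : FixedProj K G, if Even e.ord then (scalCard G : ℚ) else 0 := by exact_mod_cast h
    rw [h4, h3, Finset.mul_sum]
    refine Finset.sum_congr rfl fun ω _ => ?_
    rw [horbq]
    change (N / n ω : ℚ) * (if Even (n ω) then (scalCard G : ℚ) else 0) = _
    split_ifs <;> ring
  have hax : ∀ ω, ∃ u : G, u ∈ MulAction.stabilizer G ω.out ∧ IsAxis G (n ω) u.val :=
    fun ω => ω.out.exists_isAxis
  have hcomm : ∀ g ∈ G, ¬ IsScal g.val → ∃ ω, ∃ u, IsAxis G (n ω) u ∧ g * u = u * g := by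
    intro g hg hgs
    have h1 := FixedProj.card_fixed (K := K) hG (g := ⟨g, hg⟩) hgs
    have h2 : Nonempty {e : FixedProj K G // (⟨g, hg⟩ : G) • e = e} := by
      rw [← not_isEmpty_iff]
      intro h
      rw [Nat.card_of_isEmpty] at h1
      omega
    obtain ⟨e, he⟩ := h2
    obtain ⟨u, hu, hua⟩ := e.exists_isAxis
    refine ⟨Quotient.mk'' e, u, ?_, (e.commute_iff hua.not_isScal hu (g := ⟨g, hg⟩)).2 he⟩
    have h3 : n (Quotient.mk'' e) = e.ord :=
      FixedProj.ord_eq_of_mem_orbit (MulAction.orbitRel_apply.1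
        (Quotient.exact (Quotient.out_eq (Quotient.mk'' e : Ω))))
    rwa [h3]
  have h4 := card_le_three hn2 hNpos hsum
  obtain h0 | h1 | h2 | h3 : Fintype.card Ω = 0 ∨ Fintype.card Ω = 1 ∨ Fintype.card Ω = 2 ∨
    Fintype.card Ω = 3 := by omega
  · have hE : IsEmpty Ω := Fintype.card_eq_zero_iff.1 h0
    rw [Finset.univ_eq_empty, Finset.sum_empty] at hsum htr
    field_simp at hsum
    have hN1 : N = 1 := by
      have : (N : ℚ) = 1 := by linarith
      exact_mod_cast this
    subst hN1
    refine Or.inl ⟨1, ⟨1, G.one_mem, ?_, fun g hg => ⟨1, ?_⟩⟩, hN, fun h2 => ?_⟩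
    · rw [← isScal_iff_pord_eq_one]
      simp [IsScal]
    · by_contra hgs
      rw [one_pow, mul_one, isScal_iff_mem_center, inv_mem_iff, ← isScal_iff_mem_center] at hgs
      obtain ⟨ω, -⟩ := hcomm g hg hgs
      exact hE.false ω
    · have := htr h2
      rw [mul_zero] at this
      have : (traceZeroCard G : ℚ) = 0 := by linarith
      rw [if_neg (by decide)]
      exact_mod_cast this
  · exfalso
    obtain ⟨ω, hω⟩ := Fintype.card_eq_one_iff.1 h1
    rw [Fintype.sum_eq_single ω fun x hx => absurd (hω x) hx] at hsum
    exact classEq_one (hn2 ω) (hnN ω) hsum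
  · let e := (Fintype.equivFinOfCardEq h2).symm
    rw [← e.sum_comp, Fin.sum_univ_two] at hsum htr
    obtain ⟨ha, hb⟩ := classEq_two (hn2 _) (hn2 _) (hnN _) (hnN _) hsum
    obtain ⟨u, -, hu⟩ := hax (e 0)
    have hall : {g : G | g.val * u.val = u.val * g.val} = Set.univ := by
      rw [Set.eq_univ_iff_ncard, ← Nat.card_coe_set_eq]
      refine hu.card_eq.trans ?_
      rw [ha, hN]
    refine Or.inl ⟨N, ⟨u, u.2, hu.pord_eq.trans ha, fun g hg => hu.exists_pow g hg ?_⟩, hN,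
      fun h2 => ?_⟩
    · exact hall.ge (Set.mem_univ ⟨g, hg⟩)
    · have h5 := htr h2
      rw [ha, hb, div_self hN'] at h5
      have h6 : (traceZeroCard G : ℚ) = scalCard G * if Even N then 1 else 0 := by linarith
      split_ifs at h6 ⊢
      · rw [mul_one] at h6; exact_mod_cast h6
      · rw [mul_zero] at h6; exact_mod_cast h6
  · obtain ⟨e, hab, hbc⟩ := exists_sorted_equiv h3 n
    rw [← e.sum_comp, Fin.sum_univ_three] at hsum htr
    have hS : AxisType G {n (e 0), n (e 1), n (e 2)} N := by
      refine ⟨?_, fun g hg hgs => ?_, hN⟩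
      · rintro k (rfl | rfl | rfl)
        · exact ⟨_, (hax (e 0)).choose_spec.2⟩
        · exact ⟨_, (hax (e 1)).choose_spec.2⟩
        · exact ⟨_, (hax (e 2)).choose_spec.2⟩
      · obtain ⟨ω, u, hu, hgu⟩ := hcomm g hg hgs
        refine ⟨n ω, ?_, u, hu, hgu⟩
        obtain ⟨i, rfl⟩ := e.surjective ω
        fin_cases i <;> simp
    have hc2 := hn2 (e 2)
    have hcases := classEq_three (hn2 _) hab hbc hNpos hsum
    generalize n (e 0) = a at *
    generalize n (e 1) = b at *
    generalize n (e 2) = c at *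
    obtain ⟨rfl, rfl, rfl⟩ | ⟨rfl, rfl, hcN⟩ := hcases
    · rw [Set.insert_idem] at hS
      refine Or.inr (Or.inl ⟨c, hS, hc2, fun h2 => ?_⟩)
      have h5 := htr h2
      have hc0 : (c : ℚ) ≠ 0 := by positivity
      have h6 : (traceZeroCard G : ℚ) = (c + if Even c then 1 else 0) * scalCard G := by
        rw [if_pos (by decide)] at h5
        push_cast at h5
        split_ifs at h5 ⊢ <;> field_simp at h5 <;> linarith
      split_ifs at h6 ⊢ <;> exact_mod_cast h6
    · refine Or.inr (Or.inr ?_)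
      obtain ⟨rfl, rfl⟩ | ⟨rfl, rfl⟩ | ⟨rfl, rfl⟩ := hcN
      · refine ⟨3, 12, 3, hS, by simp, fun h2 => ?_⟩
        have h5 := htr h2
        rw [if_pos (by decide), if_neg (by decide)] at h5
        have h6 : (traceZeroCard G : ℚ) = 3 * scalCard G := by
          push_cast at h5; linarith
        exact_mod_cast h6
      · refine ⟨4, 24, 9, hS, by simp, fun h2 => ?_⟩
        have h5 := htr h2
        rw [if_pos (by decide), if_neg (by decide), if_pos (by decide)] at h5
        have h6 : (traceZeroCard G : ℚ) = 9 * scalCard G := by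
          push_cast at h5; linarith
        exact_mod_cast h6
      · refine ⟨5, 60, 15, hS, by simp, fun h2 => ?_⟩
        have h5 := htr h2
        rw [if_pos (by decide), if_neg (by decide), if_neg (by decide)] at h5
        have h6 : (traceZeroCard G : ℚ) = 15 * scalCard G := by
          push_cast at h5; linarith
        exact_mod_cast h6

end Classification

section Axes

variable {F : Type*} [Field F] {G H : Subgroup (GL (Fin 2) F)}

theorem isScal_inv_mul_iff {g h : GL (Fin 2) F} : IsScal (g⁻¹ * h).val ↔
    QuotientGroup.mk' (Subgroup.center (GL (Fin 2) F)) g = QuotientGroup.mk' _ h := by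
  rw [isScal_iff_mem_center]
  exact QuotientGroup.eq.symm

theorem pord_dvd_of_isScal {g u : GL (Fin 2) F} {i : ℕ} (h : IsScal (g⁻¹ * u ^ i).val) :
    pord g ∣ pord u := by
  rw [isScal_inv_mul_iff, map_pow] at h
  rw [pord, pord, h]
  exact orderOf_pow_dvd i

/-- If `v` is a power of `u` modulo scalars and has the same finite order, then conversely. -/
theorem exists_isScal_inv_mul_pow {u v : GL (Fin 2) F} (huv : pord v = pord u) (hu : pord u ≠ 0)
    {i : ℕ} (h : IsScal (v⁻¹ * u ^ i).val) : ∃ j : ℕ, IsScal (u⁻¹ * v ^ j).val := by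
  rw [isScal_inv_mul_iff, map_pow] at h
  simp only [isScal_inv_mul_iff, map_pow]
  rw [pord, h, (orderOf_pos_iff.1 (Nat.pos_of_ne_zero hu)).orderOf_pow, ← pord,
    Nat.div_eq_self] at huv
  obtain ⟨j, hj⟩ := exists_pow_eq_self_of_coprime
    (x := QuotientGroup.mk' (Subgroup.center (GL (Fin 2) F)) u) (n := i)
    (Nat.Coprime.symm (huv.resolve_left hu))
  exact ⟨j, by rw [h]; exact hj.symm⟩

theorem IsAxis.pord_dvd {n : ℕ} {u g : GL (Fin 2) F} (hu : IsAxis G n u) (hg : g ∈ G)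
    (hgu : g * u = u * g) : pord g ∣ n := by
  obtain ⟨i, hi⟩ := hu.exists_pow g hg hgu
  exact hu.pord_eq ▸ pord_dvd_of_isScal hi

theorem isScal_inv_mul_trans {g u v : GL (Fin 2) F} {i j : ℕ} (h : IsScal (g⁻¹ * u ^ i).val)
    (h' : IsScal (u⁻¹ * v ^ j).val) : IsScal (g⁻¹ * v ^ (j * i)).val := by
  rw [isScal_inv_mul_iff, map_pow] at *
  rw [h, h', pow_mul]

theorem IsAxis.of_commute {n : ℕ} (hn : 2 ≤ n) {u v : GL (Fin 2) F} (hu : IsAxis G n u)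
    (hv : v ∈ G) (hvn : pord v = n) (hvu : v * u = u * v) : IsAxis G n v := by
  have hvs : ¬ IsScal v.val := by
    rw [isScal_iff_pord_eq_one]; omega
  obtain ⟨i, hi⟩ := hu.exists_pow v hv hvu
  obtain ⟨j, hj⟩ := exists_isScal_inv_mul_pow (hvn.trans hu.pord_eq.symm)
    (by rw [hu.pord_eq]; omega) hi
  refine ⟨hv, hvs, hvn, ?_, fun g hg hgv => ?_⟩
  · rw [← hu.card_eq]
    refine Nat.card_congr (Equiv.subtypeEquivRight fun g => ?_)
    exact ⟨fun h => GL_commute_trans hvs h hvu.symm, fun h => GL_commute_trans hu.not_isScal h hvu⟩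
  · obtain ⟨k, hk⟩ := hu.exists_pow g hg (GL_commute_trans hvs hgv hvu.symm)
    exact ⟨_, isScal_inv_mul_trans hk hj⟩

theorem AxisType.exists_pord_dvd {S : Set ℕ} {N : ℕ} (hG : AxisType G S N) {g : GL (Fin 2) F}
    (hg : g ∈ G) (hgs : ¬ IsScal g.val) : ∃ n ∈ S, pord g ∣ n := by
  obtain ⟨n, hn, u, hu, hgu⟩ := hG.exists_commute g hg hgs
  exact ⟨n, hn, hu.pord_dvd hg hgu⟩

theorem AxisType.isAxis {S : Set ℕ} {N m : ℕ} (hG : AxisType G S N) (hm : 2 ≤ m)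
    (hmS : ∀ k ∈ S, m ∣ k → k = m) {v : GL (Fin 2) F} (hv : v ∈ G) (hvm : pord v = m) :
    IsAxis G m v := by
  have hvs : ¬ IsScal v.val := by
    rw [isScal_iff_pord_eq_one]; omega
  obtain ⟨n, hn, u, hu, hvu⟩ := hG.exists_commute v hv hvs
  have := hmS n hn (hvm ▸ hu.pord_dvd hv hvu)
  subst this
  exact hu.of_commute hm hv hvm hvu

theorem DihType.isAxis {m : ℕ} (hG : DihType G m) {v : GL (Fin 2) F} (hv : v ∈ G)
    (hvm : pord v = m) : IsAxis G m v := by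
  have hm := hG.two_le
  refine hG.toAxisType.isAxis hm ?_ hv hvm
  rintro k (rfl | rfl) h
  · exact le_antisymm hm (Nat.le_of_dvd (by norm_num) h)
  · rfl

theorem ExcType.isAxis {n N c : ℕ} (hG : ExcType G n N c) {v : GL (Fin 2) F} (hv : v ∈ G)
    (hvn : pord v = n) : IsAxis G n v := by
  have hn := hG.values
  refine hG.toAxisType.isAxis (by omega) ?_ hv hvn
  rintro k (rfl | rfl | rfl) h
  · have := Nat.le_of_dvd (by norm_num) h
    omega
  · have := Nat.le_of_dvd (by norm_num) h
    omega
  · rfl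

end Axes

section SameSig

variable {F : Type*} [Field F] {G H : Subgroup (GL (Fin 2) F)}

/-- Every element of `G` has the same trace and determinant as some element of `H`. -/
def SigLE (G H : Subgroup (GL (Fin 2) F)) : Prop :=
  ∀ g ∈ G, ∃ h ∈ H, h.val.trace = g.val.trace ∧ h.val.det = g.val.det

theorem trace_sq_of_isScal {g : GL (Fin 2) F} (hg : IsScal g.val) :
    g.val.trace ^ 2 = 4 * g.val.det := by
  obtain ⟨h1, h2, h3⟩ := hg
  rw [Matrix.trace_fin_two, Matrix.det_fin_two, h1, h3]
  ring

theorem isScal_iff_of_sig_eq (hG : NoUnip G) (hH : NoUnip H) {g h : GL (Fin 2) F} (hg : g ∈ G)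
    (hh : h ∈ H) (ht : h.val.trace = g.val.trace) (hd : h.val.det = g.val.det) :
    IsScal h.val ↔ IsScal g.val :=
  ⟨fun hs => hG g hg (by rw [← ht, ← hd, trace_sq_of_isScal hs]),
    fun hs => hH h hh (by rw [ht, hd, trace_sq_of_isScal hs])⟩

theorem pord_eq_of_sig_eq (hG : NoUnip G) (hH : NoUnip H) {g h : GL (Fin 2) F} (hg : g ∈ G)
    (hh : h ∈ H) (ht : h.val.trace = g.val.trace) (hd : h.val.det = g.val.det) :
    pord h = pord g := by
  have hiff := isScal_iff_of_sig_eq hG hH hg hh ht hd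
  by_cases hs : IsScal g.val
  · rw [isScal_iff_pord_eq_one.1 hs, isScal_iff_pord_eq_one.1 (hiff.2 hs)]
  · obtain ⟨c, hc⟩ := exists_similar (mt hiff.1 hs) hs ht hd
    rw [← hc, pord_conj]

theorem mem_of_isScal (hH : NoUnip H) (h : SigLE G H) {g : GL (Fin 2) F} (hg : g ∈ G)
    (hs : IsScal g.val) : g ∈ H := by
  obtain ⟨x, hx, ht, hd⟩ := h g hg
  have hxs : IsScal x.val := hH x hx (by rw [ht, hd, trace_sq_of_isScal hs])
  have hgx : g = x := by
    obtain ⟨a, ha⟩ := isScal_iff.1 hs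
    obtain ⟨b, hb⟩ := isScal_iff.1 hxs
    apply Units.ext
    rw [ha, hb]
    rw [ha, hb] at ht hd
    simp only [Matrix.trace_smul, Matrix.trace_one, Matrix.det_smul, Matrix.det_one,
      Fintype.card_fin, smul_eq_mul, mul_one, Nat.cast_ofNat] at ht hd
    have : (b - a) ^ 2 = 0 := by linear_combination hd - a * ht
    rw [sub_eq_zero.1 ((pow_eq_zero_iff two_ne_zero).1 this)]
  rwa [hgx]

theorem scalCard_eq (hG : NoUnip G) (hH : NoUnip H) (hGH : SigLE G H) (hHG : SigLE H G) :
    scalCard G = scalCard H :=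
  Nat.card_congr
    { toFun := fun g => ⟨⟨g.1, mem_of_isScal hH hGH g.1.2 g.2⟩, g.2⟩
      invFun := fun g => ⟨⟨g.1, mem_of_isScal hG hHG g.1.2 g.2⟩, g.2⟩
      left_inv := fun _ => rfl
      right_inv := fun _ => rfl }

theorem exists_map_conj_eq [Finite H] (hcard : Nat.card G = Nat.card H)
    {c : GL (Fin 2) F} (hc : ∀ g ∈ G, c * g * c⁻¹ ∈ H) :
    Subgroup.map (MulAut.conj c).toMonoidHom G = H := by
  refine Subgroup.eq_of_le_of_card_ge ?_ ?_
  · rintro _ ⟨g, hg, rfl⟩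
    exact hc g hg
  · rw [← hcard, Nat.card_congr (G.equivMapOfInjective (MulAut.conj c).toMonoidHom (MulAut.conj c).injective).toEquiv]

end SameSig

section Orders

variable {F : Type*} [Field F] {G H : Subgroup (GL (Fin 2) F)}

/-- The set of orders of elements of `G` modulo scalars. -/
def pordSet (G : Subgroup (GL (Fin 2) F)) : Set ℕ := {k | ∃ g ∈ G, pord g = k}

theorem pordSet_subset (hG : NoUnip G) (hH : NoUnip H) (hGH : SigLE G H) :
    pordSet G ⊆ pordSet H := by
  rintro _ ⟨g, hg, rfl⟩
  obtain ⟨h, hh, ht, hd⟩ := hGH g hg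
  exact ⟨h, hh, pord_eq_of_sig_eq hG hH hg hh ht hd⟩

theorem CycType.mem_pordSet {N : ℕ} (h : CycType G N) : N ∈ pordSet G := by
  obtain ⟨u, hu, huN, -⟩ := h.exists_gen
  exact ⟨u, hu, huN⟩

theorem CycType.dvd {N k : ℕ} (h : CycType G N) (hk : k ∈ pordSet G) : k ∣ N := by
  obtain ⟨u, hu, huN, hgen⟩ := h.exists_gen
  obtain ⟨g, hg, rfl⟩ := hk
  obtain ⟨i, hi⟩ := hgen g hg
  exact huN ▸ pord_dvd_of_isScal hi

theorem AxisType.mem_pordSet {S : Set ℕ} {N k : ℕ} (h : AxisType G S N) (hk : k ∈ S) :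
    k ∈ pordSet G := by
  obtain ⟨u, hu⟩ := h.exists_isAxis k hk
  exact ⟨u, hu.mem, hu.pord_eq⟩

theorem AxisType.exists_dvd {S : Set ℕ} {N k : ℕ} (h : AxisType G S N) (hk : k ∈ pordSet G)
    (hS : S.Nonempty) : ∃ n ∈ S, k ∣ n := by
  obtain ⟨g, hg, rfl⟩ := hk
  by_cases hs : IsScal g.val
  · obtain ⟨n, hn⟩ := hS
    exact ⟨n, hn, by rw [isScal_iff_pord_eq_one.1 hs]; exact one_dvd n⟩
  · exact h.exists_pord_dvd hg hs

theorem DihType.dvd_or {m k : ℕ} (h : DihType G m) (hk : k ∈ pordSet G) : k ∣ 2 ∨ k ∣ m := by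
  obtain ⟨l, rfl | rfl, hl⟩ := h.toAxisType.exists_dvd hk ⟨2, by simp⟩
  · exact Or.inl hl
  · exact Or.inr hl

theorem ExcType.dvd_or {n N c k : ℕ} (h : ExcType G n N c) (hk : k ∈ pordSet G) :
    k ∣ 2 ∨ k ∣ 3 ∨ k ∣ n := by
  obtain ⟨l, rfl | rfl | rfl, hl⟩ := h.toAxisType.exists_dvd hk ⟨2, by simp⟩
  · exact Or.inl hl
  · exact Or.inr (Or.inl hl)
  · exact Or.inr (Or.inr hl)

theorem CycType.eq (hG : NoUnip G) (hH : NoUnip H) (hGH : SigLE G H) (hHG : SigLE H G) {N N' : ℕ}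
    (h : CycType G N) (h' : CycType H N') : N = N' :=
  Nat.dvd_antisymm (h'.dvd (pordSet_subset hG hH hGH h.mem_pordSet))
    (h.dvd (pordSet_subset hH hG hHG h'.mem_pordSet))

theorem CycType.eq_dih (hG : NoUnip G) (hH : NoUnip H) (hGH : SigLE G H) (hHG : SigLE H G)
    {N m : ℕ} (h : CycType G N) (h' : DihType H m) : N = m ∧ Even m := by
  have h2 : 2 ∣ N := h.dvd (pordSet_subset hH hG hHG (h'.toAxisType.mem_pordSet (by simp)))
  have hm : m ∣ N := h.dvd (pordSet_subset hH hG hHG (h'.toAxisType.mem_pordSet (by simp)))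
  have := h'.two_le
  rcases h'.dvd_or (pordSet_subset hG hH hGH h.mem_pordSet) with h3 | h3
  · have hN : N = 2 := Nat.dvd_antisymm h3 h2
    subst hN
    have hm2 : m = 2 := le_antisymm (Nat.le_of_dvd (by norm_num) hm) this
    subst hm2
    exact ⟨rfl, by decide⟩
  · have hN := Nat.dvd_antisymm h3 hm
    exact ⟨hN, even_iff_two_dvd.2 (hN ▸ h2)⟩

theorem CycType.not_exc (hG : NoUnip G) (hH : NoUnip H) (hGH : SigLE G H) (hHG : SigLE H G)
    {N n M c : ℕ} (h : CycType G N) (h' : ExcType H n M c) : False := by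
  have h2 : 2 ∣ N := h.dvd (pordSet_subset hH hG hHG (h'.toAxisType.mem_pordSet (by simp)))
  have h3 : 3 ∣ N := h.dvd (pordSet_subset hH hG hHG (h'.toAxisType.mem_pordSet (by simp)))
  have h6 : 6 ∣ N := Nat.Coprime.mul_dvd_of_dvd_of_dvd (by norm_num) h2 h3
  have hv := h'.values
  rcases h'.dvd_or (pordSet_subset hG hH hGH h.mem_pordSet) with h4 | h4 | h4 <;>
  · have := Nat.le_of_dvd (by omega) (h6.trans h4)
    omega

theorem DihType.eq (hG : NoUnip G) (hH : NoUnip H) (hGH : SigLE G H) (hHG : SigLE H G) {m m' : ℕ}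
    (h : DihType G m) (h' : DihType H m') : m = m' := by
  have h1 := h'.dvd_or (pordSet_subset hG hH hGH (h.toAxisType.mem_pordSet (k := m) (by simp)))
  have h2 := h.dvd_or (pordSet_subset hH hG hHG (h'.toAxisType.mem_pordSet (k := m') (by simp)))
  have hm := h.two_le
  have hm' := h'.two_le
  have key : ∀ k, 2 ≤ k → k ∣ 2 → k = 2 := fun k hk hk2 =>
    le_antisymm (Nat.le_of_dvd (by norm_num) hk2) hk
  rcases h1 with h1 | h1 <;> rcases h2 with h2 | h2
  · rw [key _ hm h1, key _ hm' h2]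
  · have := key _ hm h1
    subst this
    exact (key _ hm' h2).symm
  · have := key _ hm' h2
    subst this
    exact key _ hm h1
  · exact Nat.dvd_antisymm h1 h2

theorem DihType.eq_three (hG : NoUnip G) (hH : NoUnip H) (hGH : SigLE G H) (hHG : SigLE H G)
    {m n N c : ℕ} (h : DihType G m) (h' : ExcType H n N c) : m = 3 ∧ n = 3 := by
  have h3 := h.dvd_or (pordSet_subset hH hG hHG (h'.toAxisType.mem_pordSet (k := 3) (by simp)))
  have hn := h.dvd_or (pordSet_subset hH hG hHG (h'.toAxisType.mem_pordSet (k := n) (by simp)))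
  have hm := h'.dvd_or (pordSet_subset hG hH hGH (h.toAxisType.mem_pordSet (k := m) (by simp)))
  have h3m : 3 ∣ m := h3.resolve_left (by norm_num)
  have hle := Nat.le_of_dvd (by have := h.two_le; omega) h3m
  have hmn : m ∣ 3 ∨ m ∣ n := hm.resolve_left fun h => by
    have := Nat.le_of_dvd (by norm_num) h
    omega
  obtain ⟨rfl, -⟩ | ⟨rfl, -⟩ | ⟨rfl, -⟩ := h'.values
  · have := Nat.le_of_dvd (by norm_num) (hmn.elim id id)
    omega
  · rcases hmn with h4 | h4 <;> have := Nat.le_of_dvd (by norm_num) h4 <;> interval_cases m <;>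
      omega
  · rcases hmn with h4 | h4 <;> have := Nat.le_of_dvd (by norm_num) h4 <;> interval_cases m <;>
      omega

theorem ExcType.eq (hG : NoUnip G) (hH : NoUnip H) (hGH : SigLE G H) (hHG : SigLE H G)
    {n N c n' N' c' : ℕ} (h : ExcType G n N c) (h' : ExcType H n' N' c') :
    n = n' ∧ N = N' ∧ c = c' := by
  have h1 := h'.dvd_or (pordSet_subset hG hH hGH (h.toAxisType.mem_pordSet (k := n) (by simp)))
  have h2 := h.dvd_or (pordSet_subset hH hG hHG (h'.toAxisType.mem_pordSet (k := n') (by simp)))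
  have hv := h.values
  have hv' := h'.values
  obtain rfl | rfl | rfl : n = 3 ∨ n = 4 ∨ n = 5 := by omega
  all_goals obtain rfl | rfl | rfl : n' = 3 ∨ n' = 4 ∨ n' = 5 := by omega
  all_goals omega

end Orders

section Cyclic

variable {F : Type*} [Field F] {G H : Subgroup (GL (Fin 2) F)}

theorem card_eq_of_modulo (hG : NoUnip G) (hH : NoUnip H) (hGH : SigLE G H) (hHG : SigLE H G)
    {N : ℕ} (h : Nat.card G = N * scalCard G) (h' : Nat.card H = N * scalCard H) :
    Nat.card G = Nat.card H := by
  rw [h, h', scalCard_eq hG hH hGH hHG]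

/-- If `g` is a power of `u` modulo scalars, then a conjugation moving `u` and the scalars of `G`
into `H` moves `g` into `H`. -/
theorem conj_mem_of_isScal (hH : NoUnip H) (hGH : SigLE G H) {u g c : GL (Fin 2) F}
    (hg : g ∈ G) (hu : u ∈ G) (hc : c * u * c⁻¹ ∈ H) {i : ℕ} (hi : IsScal (g⁻¹ * u ^ i).val) :
    c * g * c⁻¹ ∈ H := by
  have hz := mem_of_isScal hH hGH (G.mul_mem (G.inv_mem hg) (G.pow_mem hu i)) hi
  rw [isScal_iff_mem_center, Subgroup.mem_center_iff] at hi
  have h1 : c * g * c⁻¹ = (c * u * c⁻¹) ^ i * (c * (g⁻¹ * u ^ i) * c⁻¹)⁻¹ := by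
    rw [conj_pow]; group
  rw [h1, hi c, mul_inv_cancel_right]
  exact H.mul_mem (H.pow_mem hc i) (H.inv_mem hz)

theorem CycType.exists_conj [Finite H] (hG : NoUnip G) (hH : NoUnip H) (hGH : SigLE G H)
    (hHG : SigLE H G) {N : ℕ} (h : CycType G N) (h' : CycType H N) :
    ∃ c, Subgroup.map (MulAut.conj c).toMonoidHom G = H := by
  obtain ⟨u, hu, huN, hgen⟩ := h.exists_gen
  obtain ⟨v, hv, ht, hd⟩ := hGH u hu
  have hc : ∃ c, c * u * c⁻¹ ∈ H := by
    by_cases hs : IsScal u.val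
    · exact ⟨1, by simpa using mem_of_isScal hH hGH hu hs⟩
    · obtain ⟨c, hc⟩ := exists_similar hs
        (mt (isScal_iff_of_sig_eq hG hH hu hv ht hd).1 hs) ht.symm hd.symm
      exact ⟨c, hc ▸ hv⟩
  obtain ⟨c, hc⟩ := hc
  refine ⟨c, exists_map_conj_eq (card_eq_of_modulo hG hH hGH hHG h.card_eq h'.card_eq)
    fun g hg => ?_⟩
  obtain ⟨i, hi⟩ := hgen g hg
  exact conj_mem_of_isScal hH hGH hg hu hc hi

end Cyclic

section Dihedral

variable {F : Type*} [Field F] {G H : Subgroup (GL (Fin 2) F)} {m : ℕ}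

theorem DihType.mul_commute_iff [Finite G] (hG : DihType G m) {u : GL (Fin 2) F}
    (hu : IsAxis G m u) {a b : GL (Fin 2) F} (ha : a ∈ G) (hb : b ∈ G) :
    a * b * u = u * (a * b) ↔ (a * u = u * a ↔ b * u = u * b) := by
  let C := (Subgroup.centralizer {u}).subgroupOf G
  have hC : ∀ g : G, g ∈ C ↔ g.val * u = u * g.val := fun g => by
    rw [Subgroup.mem_subgroupOf, Subgroup.mem_centralizer_singleton_iff]
  have hcard : Nat.card C = m * scalCard G := by
    rw [← hu.card_eq]
    exact Nat.card_congr (Equiv.subtypeEquivRight hC)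
  have hidx : C.index = 2 := by
    have h := C.card_mul_index
    rw [hG.card_eq, hcard] at h
    have := hG.two_le
    refine Nat.eq_of_mul_eq_mul_left (Nat.mul_pos (n := m) (by omega) (scalCard_pos (G := G))) ?_
    rw [h]
    ring
  have h := Subgroup.mul_mem_iff_of_index_two hidx (a := ⟨a, ha⟩) (b := ⟨b, hb⟩)
  rwa [hC, hC, hC] at h

theorem DihType.exists_not_commute [Finite G] (hG : DihType G m) {u : GL (Fin 2) F}
    (hu : IsAxis G m u) : ∃ w ∈ G, w * u ≠ u * w := by
  by_contra! h
  have h1 : Nat.card {g : G // g.val * u = u * g.val} = Nat.card G :=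
    Nat.card_congr (Equiv.subtypeUnivEquiv fun g => h g g.2)
  rw [hu.card_eq, hG.card_eq, mul_assoc] at h1
  have := hG.two_le
  have : 0 < m * scalCard G := Nat.mul_pos (by omega) scalCard_pos
  omega

/-- Conjugation by an element which does not commute with `u`, but such that `u` and its conjugate
commute, exchanges the eigenvalues of `u`. -/
theorem trace_eq_zero_of_conj_commute (h2 : (2 : F) ≠ 0) (hG : NoUnip G) {u w : GL (Fin 2) F}
    (hu : u ∈ G) (hwu : w * u ≠ u * w) (h : w * u * w⁻¹ * u = u * (w * u * w⁻¹)) :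
    w.val.trace = 0 ∧ (u * w).val.trace = 0 := by
  have hus : ¬ IsScal u.val := fun h => hwu (mul_eq_mul_iff_val.2 (h.commute w.val).symm)
  obtain ⟨a, b, hab⟩ := exists_eq_of_commute hus (mul_eq_mul_iff_val.1 h)
  have ht := trace_conj w u
  have hd := det_conj w u
  set T := u.val.trace with hT
  set d := u.val.det with hdd
  have hne : T ^ 2 - 4 * d ≠ 0 := fun h => hus (hG u hu (by linear_combination h))
  rw [hab] at ht hd
  rw [Matrix.trace_add, Matrix.trace_smul, Matrix.trace_smul, Matrix.trace_one, ← hT] at ht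
  simp only [smul_eq_mul, Fintype.card_fin, Nat.cast_ofNat] at ht
  have hd' : a ^ 2 + a * b * T + b ^ 2 * d = d := by
    have h3 : (a • 1 + b • u.val).det = a ^ 2 + a * b * T + b ^ 2 * d := by
      rw [hT, hdd, Matrix.trace_fin_two, Matrix.det_fin_two, Matrix.det_fin_two]
      simp
      ring
    rw [← h3, hd]
  have hb : (b - 1) * (b + 1) = 0 := by
    refine (mul_eq_zero.1 ?_).resolve_right hne
    linear_combination (-4) * hd' + (2 * a + b * T + T) * ht
  have hb1 : b = -1 := by
    rcases mul_eq_zero.1 hb with hb | hb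
    · exfalso
      have hb : b = 1 := by linear_combination hb
      subst hb
      have ha : a = 0 := (mul_eq_zero.1 (by linear_combination ht : a * 2 = 0)).resolve_right h2
      subst ha
      apply hwu
      have h3 : w * u * w⁻¹ = u := Units.ext (by rw [hab]; simp)
      nth_rewrite 2 [← h3]
      group
    · linear_combination hb
  subst hb1
  have ha : a = T := by
    apply mul_right_cancel₀ h2
    linear_combination ht
  subst ha
  have hwu' : w.val * u.val = T • w.val - u.val * w.val := by
    have h3 : w * u = w * u * w⁻¹ * w := by group
    rw [← Units.val_mul, h3, Units.val_mul, hab, add_mul, smul_mul_assoc, one_mul, neg_one_smul,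
      neg_mul, sub_eq_add_neg]
  have h4 : 2 * (u * w).val.trace = T * w.val.trace := by
    have := congrArg Matrix.trace hwu'
    rw [Matrix.trace_sub, Matrix.trace_smul, Matrix.trace_mul_comm, smul_eq_mul] at this
    rw [Units.val_mul]
    linear_combination this
  have h5 : T * (u * w).val.trace = 2 * d * w.val.trace := by
    have := congrArg (fun X => Matrix.trace (u.val * X)) hwu'
    beta_reduce at this
    rw [mul_sub, mul_smul_comm, ← mul_assoc, ← mul_assoc, Matrix.trace_mul_cycle, sq_eq, sub_mul,
      smul_mul_assoc, smul_mul_assoc, one_mul, ← hT, ← hdd] at this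
    simp only [Matrix.trace_sub, Matrix.trace_smul, smul_eq_mul] at this
    rw [Units.val_mul]
    linear_combination this
  have h6 : w.val.trace = 0 := by
    refine (mul_eq_zero.1 ?_).resolve_left hne
    linear_combination -T * h4 + 2 * h5
  refine ⟨h6, (mul_eq_zero.1 ?_).resolve_left h2⟩
  rw [h4, h6, mul_zero]

theorem DihType.trace_eq_zero [Finite G] (h2 : (2 : F) ≠ 0) (hN : NoUnip G) (hG : DihType G m)
    {u : GL (Fin 2) F} (hu : IsAxis G m u) {w : GL (Fin 2) F} (hw : w ∈ G)
    (hwu : w * u ≠ u * w) : w.val.trace = 0 ∧ (u * w).val.trace = 0 := by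
  refine trace_eq_zero_of_conj_commute h2 hN hu.mem hwu ?_
  have h1 : ¬ w⁻¹ * u = u * w⁻¹ := fun h => hwu (Commute.inv_left_iff.1 h)
  have h3 : ¬ w * u * u = u * (w * u) := by
    rw [hG.mul_commute_iff hu hw hu.mem]
    simpa using hwu
  rw [hG.mul_commute_iff hu (G.mul_mem hw hu.mem) (G.inv_mem hw)]
  exact iff_of_false h3 h1

theorem IsAxis.exists_det_eq (hHG : SigLE H G) (hG : NoUnip G) {u v h : GL (Fin 2) F} (hu : u ∈ G)
    (hv : IsAxis H m v) (huv : u.val.det = v.val.det) (hh : h ∈ H) (hhv : h * v = v * h) :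
    ∃ g ∈ G, g * u = u * g ∧ g.val.det = h.val.det := by
  obtain ⟨i, hi⟩ := hv.exists_pow h hh hhv
  have hz := mem_of_isScal hG hHG (H.mul_mem (H.inv_mem hh) (H.pow_mem hv.mem i)) hi
  refine ⟨u ^ i * (h⁻¹ * v ^ i)⁻¹, G.mul_mem (G.pow_mem hu i) (G.inv_mem hz), ?_, ?_⟩
  · exact ((Commute.refl u).pow_left i).mul_left
      (Commute.inv_left (mul_eq_mul_iff_val.2 (hi.commute u.val)))
  · have h1 : h = v ^ i * (h⁻¹ * v ^ i)⁻¹ := by group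
    nth_rewrite 2 [h1]
    rw [Units.val_mul, Units.val_mul, Matrix.det_mul, Matrix.det_mul, Units.val_pow_eq_pow_val,
      Units.val_pow_eq_pow_val, Matrix.det_pow, Matrix.det_pow, huv]

theorem DihType.exists_conj [Finite G] [Finite H] (h2 : (2 : F) ≠ 0) (hG : NoUnip G)
    (hH : NoUnip H) (hGH : SigLE G H) (hHG : SigLE H G) (h : DihType G m) (h' : DihType H m) :
    ∃ c, Subgroup.map (MulAut.conj c).toMonoidHom G = H := by
  obtain ⟨u, hu⟩ := h.toAxisType.exists_isAxis m (by simp)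
  obtain ⟨v, hv, htv, hdv⟩ := hGH u hu.mem
  have hv : IsAxis H m v :=
    h'.isAxis hv ((pord_eq_of_sig_eq hG hH hu.mem hv htv hdv).trans hu.pord_eq)
  obtain ⟨w, hw, w', hw', hwu, hwv, hdet⟩ : ∃ w ∈ G, ∃ w' ∈ H, w * u ≠ u * w ∧ w' * v ≠ v * w' ∧
      w.val.det = w'.val.det := by
    obtain ⟨w, hw, hwu⟩ := h.exists_not_commute hu
    obtain ⟨x, hx, htx, hdx⟩ := hGH w hw
    by_cases hxv : x * v = v * x
    swap
    · exact ⟨w, hw, x, hx, hwu, hxv, hdx.symm⟩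
    obtain ⟨w', hw', hwv⟩ := h'.exists_not_commute hv
    obtain ⟨y, hy, hty, hdy⟩ := hHG w' hw'
    by_cases hyu : y * u = u * y
    swap
    · exact ⟨y, hy, w', hw', hyu, hwv, hdy⟩
    obtain ⟨g, hg, hgu, hdg⟩ := IsAxis.exists_det_eq hHG hG hu.mem hv hdv.symm hx hxv
    have hgy : g⁻¹ * y * u = u * (g⁻¹ * y) := (Commute.inv_left hgu).mul_left hyu
    refine ⟨w * (g⁻¹ * y), G.mul_mem hw (G.mul_mem (G.inv_mem hg) hy), w', hw', ?_, hwv, ?_⟩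
    · rw [Ne, h.mul_commute_iff hu hw (G.mul_mem (G.inv_mem hg) hy)]
      exact fun hiff => hwu (hiff.2 hgy)
    · have h1 : (g * (g⁻¹ * y)).val.det = y.val.det := by rw [mul_inv_cancel_left]
      rw [Units.val_mul, Matrix.det_mul] at h1 ⊢
      rw [← hdx, ← hdg, h1, hdy]
  obtain ⟨htw, htuw⟩ := h.trace_eq_zero h2 hG hu hw hwu
  obtain ⟨htw', htvw⟩ := h'.trace_eq_zero h2 hH hv hw' hwv
  obtain ⟨c, hcu, hcw⟩ := exists_similar_pair htv.symm hdv.symm (htw.trans htw'.symm) hdet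
    (htuw.trans htvw.symm) (hG.det_commutator_ne_zero hu.mem hw hwu.symm) hv.not_isScal
  have hC : ∀ g ∈ G, g * u = u * g → c * g * c⁻¹ ∈ H := fun g hg hgu => by
    obtain ⟨i, hi⟩ := hu.exists_pow g hg hgu
    exact conj_mem_of_isScal hH hGH hg hu.mem (hcu ▸ hv.mem) hi
  refine ⟨c, exists_map_conj_eq (card_eq_of_modulo hG hH hGH hHG h.card_eq h'.card_eq)
    fun g hg => ?_⟩
  by_cases hgu : g * u = u * g
  · exact hC g hg hgu
  · have h1 : w⁻¹ * g * u = u * (w⁻¹ * g) := by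
      rw [h.mul_commute_iff hu (G.inv_mem hw) hg]
      exact iff_of_false (fun h => hwu (Commute.inv_left_iff.1 h)) hgu
    have h3 : c * g * c⁻¹ = c * w * c⁻¹ * (c * (w⁻¹ * g) * c⁻¹) := by group
    rw [h3]
    exact H.mul_mem (hcw ▸ hw') (hC _ (G.mul_mem (G.inv_mem hw) hg) h1)

end Dihedral

section TraceArithmetic

variable {F : Type*} [Field F]

/-- The polynomial relation satisfied by trace and determinant of a nonscalar element whose image
in `PGL₂` has order dividing `2`, `3` or `n`, for `n ≤ 5`. -/
def TraceRel (n : ℕ) (t d : F) : Prop :=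
  t = 0 ∨ t ^ 2 = d ∨ n = 4 ∧ t ^ 2 = 2 * d ∨ n = 5 ∧ t ^ 4 - 3 * t ^ 2 * d + d ^ 2 = 0

theorem TraceRel.of_smul {n : ℕ} {x t d e : F} (he : e ≠ 0) (h : TraceRel n t d)
    (ht : t ^ 2 = e * x ^ 2) (hd : d = e) : TraceRel n x 1 := by
  subst hd
  rcases h with h | h | ⟨hn, h⟩ | ⟨hn, h⟩
  · left
    rw [h, zero_pow two_ne_zero, zero_eq_mul] at ht
    exact pow_eq_zero_iff two_ne_zero |>.1 (ht.resolve_left he)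
  · right; left
    exact mul_left_cancel₀ he (by linear_combination h - ht)
  · right; right; left
    exact ⟨hn, mul_left_cancel₀ he (by linear_combination h - ht)⟩
  · right; right; right
    refine ⟨hn, mul_left_cancel₀ (pow_ne_zero 2 he) ?_⟩
    linear_combination h + (-(t ^ 2 + d * x ^ 2) + 3 * d) * ht

theorem mul_eq_of_traceRel_three (h2 : (2 : F) ≠ 0) (h3 : (3 : F) ≠ 0) {a : F}
    (ha : TraceRel 3 a 1) (hb : TraceRel 3 (1 - a) 1) : a * (1 - a) = 0 := by
  have h (x : F) (hx : TraceRel 3 x 1) : x * (x - 1) * (x + 1) = 0 := by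
    rcases hx with h | h | h | h
    · rw [h]; ring
    · linear_combination x * h
    all_goals omega
  have h6 : (6 : F) ≠ 0 := by
    convert mul_ne_zero h2 h3 using 1
    norm_num
  have ha := h a ha
  have hb := h _ hb
  rcases mul_eq_zero.1 ha with ha | ha
  · linear_combination -ha
  · have ha : a = -1 := by linear_combination ha
    subst ha
    exact absurd (by linear_combination hb) h6

theorem mul_eq_of_traceRel_four (h2 : (2 : F) ≠ 0) (h3 : (3 : F) ≠ 0) {a : F}
    (ha : TraceRel 4 a 1) (hb : TraceRel 4 (2 - a) 1) (hc : TraceRel 4 (2 - a * (2 - a)) 1) :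
    a * (2 - a) = 1 := by
  have h (x : F) (hx : TraceRel 4 x 1) : x * (x ^ 2 - 1) * (x ^ 2 - 2) = 0 := by
    rcases hx with h | h | h | h
    · rw [h]; ring
    · rw [h]; ring
    · rw [h.2]; ring
    · omega
  have h2' (k : ℕ) : (2 : F) ^ k ≠ 0 := pow_ne_zero k h2
  have h3' := mul_ne_zero (h2' 3) h3
  have hb := h _ hb
  have hc := h _ hc
  rcases ha with rfl | ha | ha | ha
  · exact absurd (by linear_combination 2 * hb) h3'
  · rcases sq_eq_sq_iff_eq_or_eq_neg.1 (ha.trans (one_pow 2).symm) with rfl | rfl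
    · norm_num
    · exact absurd (by linear_combination 33 * hb - 2 * hc) h3'
  · exact absurd (by linear_combination (15 - a) * hb + (1 + a) * hc
      - (-92 + 391 * a + -635 * a ^ 2 + 629 * a ^ 3 + -472 * a ^ 4 + 281 * a ^ 5 + -128 * a ^ 6
        + 42 * a ^ 7 + -9 * a ^ 8 + 1 * a ^ 9) * ha.2) (h2' 3)
  · omega

theorem mul_eq_of_traceRel_five (h2 : (2 : F) ≠ 0) (h3 : (3 : F) ≠ 0) (h5 : (5 : F) ≠ 0) {a f : F}
    (hf : f ^ 2 = f + 1) (ha : TraceRel 5 a 1) (hb : TraceRel 5 (f + 1 - a) 1)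
    (hc : TraceRel 5 (f * (a - 1)) 1) : a * (f + 1 - a) = f := by
  have h (x : F) (hx : TraceRel 5 x 1) : x * (x ^ 2 - 1) * (x ^ 4 - 3 * x ^ 2 + 1) = 0 := by
    rcases hx with h | h | h | h
    · rw [h]; ring
    · rw [h]; ring
    · omega
    · linear_combination x * (x ^ 2 - 1) * h.2
  have h20 : (20 : F) ≠ 0 := by
    convert mul_ne_zero (mul_ne_zero h2 h2) h5 using 1
    norm_num
  have h30 : (30 : F) ≠ 0 := by
    convert mul_ne_zero (mul_ne_zero h2 h3) h5 using 1
    norm_num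
  have h60 : (60 : F) ≠ 0 := by
    convert mul_ne_zero h2 h30 using 1
    norm_num
  have ha : a = 0 ∨ a = 1 ∨ a = -1 ∨ a = f ∨ a = -f ∨ a = f - 1 ∨ a = 1 - f := by
    have h0 : a * ((a - 1) * ((a + 1) * ((a - f) * ((a + f) * ((a - (f - 1)) *
        (a - (1 - f))))))) = 0 := by
      linear_combination h a ha
        + (a * (a ^ 2 - 1) * (-2 * a ^ 2 + (f ^ 2 - f - 1) + 2)) * hf
    simpa only [mul_eq_zero, sub_eq_zero, add_eq_zero_iff_eq_neg] using h0
  have hb := h _ hb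
  have hc := h _ hc
  rcases ha with rfl | rfl | rfl | rfl | rfl | rfl | rfl
  · exact absurd (by linear_combination -(76 - 47 * f) * hb + (-20 + 172 * f + 246 * f ^ 2
      + -327 * f ^ 3 + -614 * f ^ 4 + -300 * f ^ 5 + -47 * f ^ 6) * hf) h20
  · ring
  · exact absurd (by linear_combination (-9 * f) * hb + (-43 + 5 * f) * hc - (30 + 326 * f
      + 1269 * f ^ 2 + 1065 * f ^ 3 + 4000 * f ^ 4 + 4729 * f ^ 5 + -649 * f ^ 6) * hf) h30
  · ring
  · exact absurd (by linear_combination (233 - 144 * f) * hb + (-60 + -872 * f + -5136 * f ^ 2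
      + 6432 * f ^ 3 + 45504 * f ^ 4 + 53120 * f ^ 5 + 18432 * f ^ 6) * hf) h60
  · exact absurd (by linear_combination hb) h30
  · exact absurd (by linear_combination (76 - 47 * f) * hc - (20 + -20 * f + -36 * f ^ 2
      + 63 * f ^ 3 + -99 * f ^ 4 + 162 * f ^ 5 + 43 * f ^ 6 + -69 * f ^ 7 + 112 * f ^ 8
      + -181 * f ^ 9 + -11 * f ^ 10 + 18 * f ^ 11 + -29 * f ^ 12 + 47 * f ^ 13) * hf) h20

end TraceArithmetic

section Exceptional

variable {F : Type*} [Field F] {G H : Subgroup (GL (Fin 2) F)} {n N c : ℕ}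

theorem pow_sub_eq_zero_of_pord_dvd {g : GL (Fin 2) F} (hg : ¬ IsScal g.val) {k : ℕ}
    (hk : pord g ∣ k) {a b : F} (h : g.val ^ k = a • g.val - b • 1) : a = 0 := by
  rw [← isScal_pow_iff, Units.val_pow_eq_pow_val, h] at hk
  exact isScal_smul_sub hg hk

theorem ExcType.traceRel (hG : ExcType G n N c) {g : GL (Fin 2) F} (hg : g ∈ G)
    (hgs : ¬ IsScal g.val) : TraceRel n g.val.trace g.val.det := by
  have h3 (h : pord g ∣ 3) := sub_eq_zero.1 (pow_sub_eq_zero_of_pord_dvd hgs h (pow_three_eq g.val))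
  rcases hG.dvd_or ⟨g, hg, rfl⟩ with h | h | h
  · exact Or.inl (pow_sub_eq_zero_of_pord_dvd hgs h ((pow_two _).trans (sq_eq g.val)))
  · exact Or.inr (Or.inl (h3 h))
  rcases hG.values with ⟨rfl, -⟩ | ⟨rfl, -⟩ | ⟨rfl, -⟩
  · exact Or.inr (Or.inl (h3 h))
  · rcases mul_eq_zero.1 (pow_sub_eq_zero_of_pord_dvd hgs h (pow_four_eq g.val)) with h | h
    · exact Or.inl h
    · exact Or.inr (Or.inr (Or.inl ⟨rfl, sub_eq_zero.1 h⟩))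
  · exact Or.inr (Or.inr (Or.inr ⟨rfl, pow_sub_eq_zero_of_pord_dvd hgs h (pow_five_eq g.val)⟩))

theorem ExcType.trace_axis (hG : ExcType G n N c) {u : GL (Fin 2) F} (hu : pord u = n) :
    u.val.trace ≠ 0 ∧ (n = 3 ∧ u.val.trace ^ 2 = u.val.det ∨
      n = 4 ∧ u.val.trace ^ 2 = 2 * u.val.det ∨
      n = 5 ∧ u.val.trace ^ 4 - 3 * u.val.trace ^ 2 * u.val.det + u.val.det ^ 2 = 0) := by
  have hv := hG.values
  have hus : ¬ IsScal u.val := by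
    rw [isScal_iff_pord_eq_one]
    omega
  have ht : u.val.trace ≠ 0 := fun h => by
    have h1 : pord u ∣ 2 := by
      rw [← isScal_pow_iff, Units.val_pow_eq_pow_val, pow_two, sq_eq, h, isScal_iff]
      exact ⟨-u.val.det, by module⟩
    have := Nat.le_of_dvd two_pos h1
    omega
  refine ⟨ht, ?_⟩
  rcases hv with ⟨rfl, -⟩ | ⟨rfl, -⟩ | ⟨rfl, -⟩
  · exact Or.inl ⟨rfl, sub_eq_zero.1 (pow_sub_eq_zero_of_pord_dvd hus hu.dvd (pow_three_eq u.val))⟩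
  · exact Or.inr (Or.inl ⟨rfl, sub_eq_zero.1 ((mul_eq_zero.1
      (pow_sub_eq_zero_of_pord_dvd hus hu.dvd (pow_four_eq u.val))).resolve_left ht)⟩)
  · exact Or.inr (Or.inr ⟨rfl, pow_sub_eq_zero_of_pord_dvd hus hu.dvd (pow_five_eq u.val)⟩)

/-- Some conjugate of an element of maximal projective order does not commute with it. -/
theorem ExcType.exists_conj_not_commute [Finite G] (h2 : (2 : F) ≠ 0) (hN : NoUnip G)
    (hG : ExcType G n N c) {u : GL (Fin 2) F} (hu : IsAxis G n u) :
    ∃ g ∈ G, u * (g * u * g⁻¹) ≠ g * u * g⁻¹ * u := by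
  classical
  by_contra! h
  have := Fintype.ofFinite G
  have h1 : Nat.card G ≤ Nat.card {g : G // g.val * u = u * g.val} + traceZeroCard G := by
    rw [traceZeroCard, Nat.card_eq_fintype_card (α := G), Nat.card_eq_fintype_card,
      Nat.card_eq_fintype_card, Fintype.card_subtype fun g : G => g.val * u = u * g.val,
      Fintype.card_subtype fun g : G => g.val.val.trace = 0, ← Finset.card_univ]
    refine le_trans (Finset.card_le_card fun g _ => ?_) (Finset.card_union_le _ _)
    rw [Finset.mem_union, Finset.mem_filter, Finset.mem_filter]
    by_cases hgu : g.val * u = u * g.val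
    · exact Or.inl ⟨Finset.mem_univ _, hgu⟩
    · exact Or.inr ⟨Finset.mem_univ _,
        (trace_eq_zero_of_conj_commute h2 hN hu.mem hgu (h g g.2).symm).1⟩
  rw [hu.card_eq, hG.card_eq, hG.traceZeroCard_eq h2, ← add_mul] at h1
  have h3 := Nat.le_of_mul_le_mul_right h1 scalCard_pos
  have := hG.values
  omega

theorem trace_mul_add (x y : GL (Fin 2) F) :
    (x * y).val.trace + x.val.det * (x⁻¹ * y).val.trace = x.val.trace * y.val.trace := by
  have h := sq_eq x.val
  have h1 : x.val * y.val = x.val.trace • y.val - x.val.det • (x⁻¹ * y).val := by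
    have h3 : y.val = x.val * (x⁻¹ * y).val := by rw [← Units.val_mul, mul_inv_cancel_left]
    nth_rewrite 1 [h3]
    rw [← mul_assoc, h, sub_mul, smul_mul_assoc, smul_mul_assoc, one_mul, ← h3]
  rw [Units.val_mul, h1, Matrix.trace_sub, Matrix.trace_smul, Matrix.trace_smul]
  simp

theorem trace_sq_mul (x y : GL (Fin 2) F) :
    (x * x * y).val.trace = x.val.trace * (x * y).val.trace - x.val.det * y.val.trace := by
  rw [Units.val_mul, Units.val_mul, sq_eq, sub_mul, smul_mul_assoc, smul_mul_assoc, one_mul,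
    Matrix.trace_sub, Matrix.trace_smul, Matrix.trace_smul, Units.val_mul, smul_eq_mul, smul_eq_mul]

theorem trace_mul_comm_val (x y : GL (Fin 2) F) : (x * y).val.trace = (y * x).val.trace := by
  rw [Units.val_mul, Units.val_mul, Matrix.trace_mul_comm]

theorem det_mul_val (x y : GL (Fin 2) F) : (x * y).val.det = x.val.det * y.val.det := by
  rw [Units.val_mul, Matrix.det_mul]

theorem trace_mul_conj {x y : GL (Fin 2) F} (ht : y.val.trace = x.val.trace)
    (hd : y.val.det = x.val.det) :
    x.val.det * (y * (x * y * x⁻¹)).val.trace = x.val.trace ^ 2 * (x * y).val.trace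
      - x.val.trace ^ 2 * x.val.det - (x * y).val.trace ^ 2 + 2 * x.val.det ^ 2 := by
  have h1 := trace_mul_add x (y * x * y)
  have h3 : (y * (x * y * x⁻¹)).val.trace = (x⁻¹ * (y * x * y)).val.trace := by
    rw [trace_mul_comm_val x⁻¹]
    congr 2
    group
  have h4 : (y * x * y).val.trace = x.val.trace * (x * y).val.trace - x.val.det * x.val.trace := by
    rw [trace_mul_comm_val, ← mul_assoc, trace_sq_mul, ht, hd, trace_mul_comm_val y x]
  have h5 : (x * (y * x * y)).val.trace = (x * y).val.trace ^ 2 - 2 * x.val.det ^ 2 := by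
    have h6 : x * (y * x * y) = x * y * (x * y) * 1 := by group
    rw [h6, trace_sq_mul, mul_one, det_mul_val, hd, Units.val_one, Matrix.trace_one]
    simp
    ring
  rw [h3]
  linear_combination h1 - h5 + x.val.trace * h4

theorem commute_of_isScal_inv_mul {x y : GL (Fin 2) F} (h : IsScal (x⁻¹ * y).val) :
    x * y = y * x := by
  have h1 : x * (x⁻¹ * y) = x⁻¹ * y * x := mul_eq_mul_iff_val.2 (h.commute x.val).symm
  rw [mul_inv_cancel_left] at h1
  nth_rewrite 1 [h1]
  group

/-- An exceptional group contains a pair of conjugate elements with prescribed traces, determinants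
and trace of the product. -/
theorem ExcType.exists_pair [Finite G] (h2 : (2 : F) ≠ 0) (h3 : (3 : F) ≠ 0)
    (h5 : n = 5 → (5 : F) ≠ 0) (hN : NoUnip G) (hG : ExcType G n N c) {u : GL (Fin 2) F}
    (hu : IsAxis G n u) : ∃ y ∈ G, ∃ z ∈ G, y.val.trace = u.val.trace ∧ y.val.det = u.val.det ∧
      z.val.trace = u.val.trace ∧ z.val.det = u.val.det ∧ (y * z).val.trace = u.val.det ∧
      y * z ≠ z * y ∧ pord y = n := by
  obtain ⟨g, hg, hne⟩ := hG.exists_conj_not_commute h2 hN hu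
  have hy : g * u * g⁻¹ ∈ G := G.mul_mem (G.mul_mem hg hu.mem) (G.inv_mem hg)
  have hty := trace_conj g u
  have hdy := det_conj g u
  have hpy := (pord_conj g u).trans hu.pord_eq
  set y := g * u * g⁻¹
  have hz : u * y * u⁻¹ ∈ G := G.mul_mem (G.mul_mem hu.mem hy) (G.inv_mem hu.mem)
  obtain ⟨hT, hcase⟩ := hG.trace_axis hu.pord_eq
  have hyz : y * (u * y * u⁻¹) ≠ u * y * u⁻¹ * y := fun h =>
    hT (trace_eq_zero_of_conj_commute h2 hN hy hne h.symm).1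
  refine ⟨y, hy, u * y * u⁻¹, hz, hty, hdy, (trace_conj u y).trans hty, (det_conj u y).trans hdy,
    ?_, hyz, hpy⟩
  have hd0 := det_val_ne_zero u
  have hdiv (v w : GL (Fin 2) F) (h : w.val.det = v.val.det) : (v⁻¹ * w).val.det = 1 := by
    have h1 := det_mul_val v (v⁻¹ * w)
    rw [mul_inv_cancel_left, h] at h1
    exact mul_left_cancel₀ (det_val_ne_zero v) (by rw [← h1, mul_one])
  have hkey := trace_mul_conj hty hdy
  have hra := hG.traceRel (G.mul_mem hu.mem hy) fun h => hne <| by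
    have h1 : u * (u * y) = u * y * u := mul_eq_mul_iff_val.2 (h.commute u.val).symm
    exact mul_left_cancel (h1.trans (mul_assoc _ _ _))
  have hrb := hG.traceRel (G.mul_mem (G.inv_mem hu.mem) hy) fun h =>
    hne (commute_of_isScal_inv_mul h)
  have hrc := hG.traceRel (G.mul_mem (G.inv_mem hy) hz) fun h =>
    hyz (commute_of_isScal_inv_mul h)
  have hrw := hG.traceRel (G.mul_mem (G.mul_mem hu.mem hu.mem) hy) fun h => hne <| by
    have h1 : u * (u * u * y) = u * u * y * u := mul_eq_mul_iff_val.2 (h.commute u.val).symm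
    simp only [mul_assoc] at h1
    exact mul_left_cancel (mul_left_cancel h1)
  have htb := trace_mul_add u y
  have htc := trace_mul_add y (u * y * u⁻¹)
  rw [hdiv u y hdy] at hrb
  rw [hdiv y _ (det_conj u y)] at hrc
  rw [trace_sq_mul, hty, det_mul_val, det_mul_val, hdy] at hrw
  rw [det_mul_val, hdy] at hra
  rw [hty] at htb
  rw [trace_conj u y, hty, hdy] at htc
  clear_value y
  set T := u.val.trace
  set d := u.val.det
  obtain ⟨a, ha⟩ : ∃ a, (u * y).val.trace = a * d := ⟨_, (div_mul_cancel₀ _ hd0).symm⟩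
  obtain ⟨ψ, hψ⟩ : ∃ ψ, T ^ 2 = ψ * d := ⟨_, (div_mul_cancel₀ _ hd0).symm⟩
  have hb : (u⁻¹ * y).val.trace = ψ - a :=
    mul_left_cancel₀ hd0 (by linear_combination htb - ha + hψ)
  have hp : (y * (u * y * u⁻¹)).val.trace = d * (a * (ψ - a) - ψ + 2) := by
    rw [ha] at hkey
    exact mul_left_cancel₀ hd0 (by linear_combination hkey + (a * d - d) * hψ)
  have hc : (y⁻¹ * (u * y * u⁻¹)).val.trace = 2 * ψ - 2 - a * (ψ - a) :=
    mul_left_cancel₀ hd0 (by linear_combination htc - hp + hψ)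
  rw [ha] at hra hrw
  rw [hb] at hrb
  rw [hc] at hrc
  replace hra := hra.of_smul (x := a) (pow_ne_zero 2 hd0) (by ring) (by ring)
  suffices h : a * (ψ - a) = ψ - 1 by
    rw [hp, h]
    ring
  rcases hcase with ⟨rfl, h⟩ | ⟨rfl, h⟩ | ⟨rfl, h⟩
  · have h1 : ψ = 1 := mul_right_cancel₀ hd0 (by linear_combination h - hψ)
    subst h1
    rw [mul_eq_of_traceRel_three h2 h3 hra hrb]
    ring
  · have h1 : ψ = 2 := mul_right_cancel₀ hd0 (by linear_combination h - hψ)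
    subst h1
    rw [mul_eq_of_traceRel_four h2 h3 hra hrb (by convert hrc using 1; ring)]
    ring
  · have h1 : ψ ^ 2 - 3 * ψ + 1 = 0 := mul_right_cancel₀ (pow_ne_zero 2 hd0)
      (by linear_combination h + (-T ^ 2 - ψ * d + 3 * d) * hψ)
    obtain ⟨f, rfl⟩ : ∃ f, ψ = f + 1 := ⟨ψ - 1, by ring⟩
    rw [mul_eq_of_traceRel_five h2 h3 (h5 rfl) (f := f) (by linear_combination h1) hra hrb
      (hrw.of_smul (pow_ne_zero 3 hd0) ?_ (by ring))]
    · ring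
    · linear_combination (d ^ 2 * (a - 1) ^ 2) * hψ - d ^ 3 * (a - 1) ^ 2 * h1

end Exceptional

section Generation

variable {F : Type*} [Field F] {G H K : Subgroup (GL (Fin 2) F)} {n N c : ℕ}

theorem ExcType.le_of_mem [Finite G] (h2 : (2 : F) ≠ 0) (hN : NoUnip G) (hG : ExcType G n N c)
    (hK : K ≤ G) (hs : ∀ g ∈ G, IsScal g.val → g ∈ K) {y z : GL (Fin 2) F} (hy : y ∈ K)
    (hz : z ∈ K) (hty : y.val.trace ≠ 0) (htz : z.val.trace ≠ 0) (hyz : y * z ≠ z * y)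
    (hyn : pord y = n) : G ≤ K := by
  have : Finite K := Finite.of_injective _ (Subgroup.inclusion_injective hK)
  have hNK : NoUnip K := fun g hg => hN g (hK hg)
  have hsc : scalCard K = scalCard G := by
    rw [scalCard, scalCard]
    refine Nat.card_congr ⟨fun g => ⟨⟨g, hK g.1.2⟩, g.2⟩, fun g => ⟨⟨g, hs g g.1.2 g.2⟩, g.2⟩,
      fun _ => rfl, fun _ => rfl⟩
  rcases classification hNK with ⟨N', h⟩ | ⟨m, h⟩ | ⟨n', N', c', h⟩
  · exfalso
    obtain ⟨u, -, -, hu⟩ := h.exists_gen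
    obtain ⟨i, hi⟩ := hu y hy
    obtain ⟨j, hj⟩ := hu z hz
    have hyu := commute_of_isScal_inv_mul_pow hi
    have hzu := commute_of_isScal_inv_mul_pow hj
    by_cases hus : IsScal u.val
    · refine hyz (mul_eq_mul_iff_val.2 (IsScal.commute ?_ _))
      rw [isScal_iff_pord_eq_one]
      exact Nat.dvd_one.1 ((isScal_iff_pord_eq_one.1 hus) ▸ pord_dvd_of_isScal hi)
    · exact hyz (GL_commute_trans hus hyu hzu)
  · exfalso
    obtain ⟨v, hv⟩ := h.toAxisType.exists_isAxis m (by simp)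
    have hcomm : ∀ x ∈ K, x.val.trace ≠ 0 → x * v = v * x := fun x hx htx => by
      by_contra hxv
      exact htx (h.trace_eq_zero h2 hNK hv hx hxv).1
    exact hyz (GL_commute_trans hv.not_isScal (hcomm y hy hty) (hcomm z hz htz))
  · have hdvd : N' ∣ N := by
      refine Nat.dvd_of_mul_dvd_mul_right (scalCard_pos (G := G)) ?_
      rw [← hG.card_eq, ← hsc, ← h.card_eq]
      exact Subgroup.card_dvd_of_le hK
    have hn := h.dvd_or ⟨y, hy, hyn⟩
    have hNN : N' = N := by
      rcases hG.values with ⟨rfl, rfl, -⟩ | ⟨rfl, rfl, -⟩ | ⟨rfl, rfl, -⟩ <;>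
      rcases h.values with ⟨rfl, rfl, -⟩ | ⟨rfl, rfl, -⟩ | ⟨rfl, rfl, -⟩ <;> omega
    rw [Subgroup.eq_of_le_of_card_ge hK (by rw [hG.card_eq, h.card_eq, hNN, hsc])]

theorem ExcType.exists_conj [Finite G] [Finite H] (h2 : (2 : F) ≠ 0) (h3 : (3 : F) ≠ 0)
    (h5 : n = 5 → (5 : F) ≠ 0) (hG : NoUnip G) (hH : NoUnip H) (hGH : SigLE G H)
    (hHG : SigLE H G) (h : ExcType G n N c) (h' : ExcType H n N c) :
    ∃ c, Subgroup.map (MulAut.conj c).toMonoidHom G = H := by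
  obtain ⟨u, hu⟩ := h.toAxisType.exists_isAxis n (by simp)
  obtain ⟨v, hv, htv, hdv⟩ := hGH u hu.mem
  have hv : IsAxis H n v :=
    h'.isAxis hv ((pord_eq_of_sig_eq hG hH hu.mem hv htv hdv).trans hu.pord_eq)
  obtain ⟨y, hy, z, hz, hty, hdy, htz, hdz, htyz, hyz, hyn⟩ := h.exists_pair h2 h3 h5 hG hu
  obtain ⟨y', hy', z', hz', hty', hdy', htz', hdz', htyz', hyz', -⟩ :=
    h'.exists_pair h2 h3 h5 hH hv
  have hT := (h.trace_axis hu.pord_eq).1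
  obtain ⟨c, hcy, hcz⟩ := exists_similar_pair (x := y) (y := z) (x' := y') (y' := z')
    (by rw [hty, hty', htv]) (by rw [hdy, hdy', hdv]) (by rw [htz, htz', htv])
    (by rw [hdz, hdz', hdv]) (by rw [htyz, htyz', hdv])
    (hG.det_commutator_ne_zero hy hz hyz)
    (fun hs => hyz' (mul_eq_mul_iff_val.2 (hs.commute z'.val)))
  refine ⟨c, exists_map_conj_eq (card_eq_of_modulo hG hH hGH hHG h.card_eq h'.card_eq) ?_⟩
  have hle : G ≤ G ⊓ H.comap (MulAut.conj c).toMonoidHom := by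
    refine h.le_of_mem h2 hG inf_le_left (fun g hg hs => ⟨hg, ?_⟩) (y := y) (z := z)
      ⟨hy, ?_⟩ ⟨hz, ?_⟩ (hty ▸ hT) (htz ▸ hT) hyz hyn
    · have h1 : c * g = g * c := mul_eq_mul_iff_val.2 (hs.commute c.val).symm
      change c * g * c⁻¹ ∈ H
      rw [h1, mul_inv_cancel_right]
      exact mem_of_isScal hH hGH hg hs
    · change c * y * c⁻¹ ∈ H
      rwa [hcy]
    · change c * z * c⁻¹ ∈ H
      rwa [hcz]
  exact fun g hg => (hle hg).2

end Generation

section Comparison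

variable {F : Type*} [Field F] {G H : Subgroup (GL (Fin 2) F)} {n N c m : ℕ}

/-- The proportion of trace-zero elements of a group of invertible `2 × 2` matrices. -/
noncomputable def traceZeroRatio (G : Subgroup (GL (Fin 2) F)) : ℚ :=
  traceZeroCard G / Nat.card G

theorem traceZeroRatio_eq [Finite G] {k N : ℕ} (hk : traceZeroCard G = k * scalCard G)
    (hN : Nat.card G = N * scalCard G) : traceZeroRatio G = k / N := by
  have h : (scalCard G : ℚ) ≠ 0 := Nat.cast_ne_zero.2 scalCard_pos.ne'
  rw [traceZeroRatio, hk, hN]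
  push_cast
  exact mul_div_mul_right _ _ h

theorem CycType.traceZeroRatio_eq [Finite G] (h2 : (2 : F) ≠ 0) (h : CycType G N) (hN : Even N) :
    traceZeroRatio G = 1 / N := by
  rw [_root_.traceZeroRatio_eq (k := 1) (by rw [h.traceZeroCard_eq h2, if_pos hN, one_mul])
    h.card_eq, Nat.cast_one]

theorem DihType.two_ne_zero (hG : ∀ p : ℕ, p.Prime → p ∣ Nat.card G → (p : F) ≠ 0)
    (h : DihType G m) : (2 : F) ≠ 0 :=
  mod_cast hG 2 Nat.prime_two ⟨m * scalCard G, by rw [h.card_eq, mul_assoc]⟩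

theorem ExcType.natCast_ne_zero (hG : ∀ p : ℕ, p.Prime → p ∣ Nat.card G → (p : F) ≠ 0)
    (h : ExcType G n N c) : (2 : F) ≠ 0 ∧ (3 : F) ≠ 0 ∧ (n = 5 → (5 : F) ≠ 0) := by
  have hp (p : ℕ) (hp : p.Prime) (hpN : p ∣ N) : (p : F) ≠ 0 :=
    hG p hp (h.card_eq ▸ hpN.mul_right _)
  have h2 := hp 2 Nat.prime_two
  have h3 := hp 3 Nat.prime_three
  have h5 := hp 5 Nat.prime_five
  have hv := h.values
  push_cast at h2 h3 h5
  exact ⟨h2 (by omega), h3 (by omega), fun hn => h5 (by omega)⟩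

theorem CycType.quarter_le_sub [Finite G] [Finite H] (hG : NoUnip G) (hH : NoUnip H)
    (hGH : SigLE G H) (hHG : SigLE H G) (h2 : (2 : F) ≠ 0) (h : CycType G N) (h' : DihType H m) :
    1 / 4 ≤ traceZeroRatio H - traceZeroRatio G := by
  obtain ⟨rfl, hm⟩ := h.eq_dih hG hH hGH hHG h'
  rw [h.traceZeroRatio_eq h2 hm,
    _root_.traceZeroRatio_eq (h'.traceZeroCard_eq h2) h'.card_eq, if_pos hm]
  have h3 : (2 : ℚ) ≤ N := mod_cast h'.two_le
  push_cast
  rw [div_sub_div _ _ (by positivity) (by positivity), div_le_div_iff₀ (by norm_num) (by positivity)]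
  nlinarith

theorem DihType.quarter_le_sub [Finite G] [Finite H] (hG : NoUnip G) (hH : NoUnip H)
    (hGH : SigLE G H) (hHG : SigLE H G) (h2 : (2 : F) ≠ 0) (h : DihType G m)
    (h' : ExcType H n N c) : 1 / 4 ≤ traceZeroRatio G - traceZeroRatio H := by
  obtain ⟨rfl, hn⟩ := h.eq_three hG hH hGH hHG h'
  have hv := h'.values
  obtain ⟨rfl, rfl⟩ : N = 12 ∧ c = 3 := by omega
  rw [_root_.traceZeroRatio_eq (h.traceZeroCard_eq h2) h.card_eq,
    _root_.traceZeroRatio_eq (h'.traceZeroCard_eq h2) h'.card_eq]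
  norm_num [show ¬ Even 3 by decide]

/-- Two finite groups without unipotent elements, of order invertible in the field, which have the
same pairs (trace, determinant), are either conjugate or have very different proportions of
trace-zero elements. -/
theorem exists_conj_or_quarter_le [Finite G] [Finite H] (hG : NoUnip G) (hH : NoUnip H)
    (hGH : SigLE G H) (hHG : SigLE H G) (hG' : ∀ p : ℕ, p.Prime → p ∣ Nat.card G → (p : F) ≠ 0)
    (hH' : ∀ p : ℕ, p.Prime → p ∣ Nat.card H → (p : F) ≠ 0) :
    (∃ c, Subgroup.map (MulAut.conj c).toMonoidHom G = H) ∨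
      1 / 4 ≤ |traceZeroRatio G - traceZeroRatio H| := by
  rcases classification hG with ⟨N, h⟩ | ⟨m, h⟩ | ⟨n, N, c, h⟩ <;>
  rcases classification hH with ⟨N', h'⟩ | ⟨m', h'⟩ | ⟨n', N', c', h'⟩
  · obtain rfl := h.eq hG hH hGH hHG h'
    exact Or.inl (h.exists_conj hG hH hGH hHG h')
  · rw [abs_sub_comm]
    exact Or.inr ((h.quarter_le_sub hG hH hGH hHG (h'.two_ne_zero hH') h').trans (le_abs_self _))
  · exact (h.not_exc hG hH hGH hHG h').elim
  · exact Or.inr ((h'.quarter_le_sub hH hG hHG hGH (h.two_ne_zero hG') h).trans (le_abs_self _))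
  · obtain rfl := h.eq hG hH hGH hHG h'
    exact Or.inl (h.exists_conj (h.two_ne_zero hG') hG hH hGH hHG h')
  · exact Or.inr ((h.quarter_le_sub hG hH hGH hHG (h.two_ne_zero hG') h').trans (le_abs_self _))
  · exact (h'.not_exc hH hG hHG hGH h).elim
  · rw [abs_sub_comm]
    exact Or.inr ((h'.quarter_le_sub hH hG hHG hGH (h'.two_ne_zero hH') h).trans (le_abs_self _))
  · obtain ⟨rfl, rfl, rfl⟩ := h.eq hG hH hGH hHG h'
    obtain ⟨h2, h3, h5⟩ := h.natCast_ne_zero hG'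
    exact Or.inl (h.exists_conj h2 h3 h5 hG hH hGH hHG h')

end Comparison

section PrimeField

variable {ℓ : ℕ} [Fact (Nat.Prime ℓ)] {G H : Subgroup (GL2 ℓ)}

theorem exists_double_root {t d : ZMod ℓ} (h : t ^ 2 = 4 * d) : ∃ a, t = 2 * a ∧ d = a ^ 2 := by
  by_cases h2 : (2 : ZMod ℓ) = 0
  · have hℓ : ℓ = 2 :=
      (Nat.prime_dvd_prime_iff_eq Fact.out Nat.prime_two).1
        ((ZMod.natCast_eq_zero_iff 2 ℓ).1 (mod_cast h2))
    subst hℓ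
    refine ⟨d, ?_, (ZMod.pow_card d).symm⟩
    rw [h2, zero_mul]
    exact pow_eq_zero_iff two_ne_zero |>.1 (by linear_combination h + 2 * d * h2)
  · refine ⟨t / 2, (mul_div_cancel₀ t h2).symm, ?_⟩
    field_simp
    linear_combination -h

theorem noUnip_of_orderOf_ne (hord : ∀ g ∈ G, orderOf g ≠ ℓ) : NoUnip G := by
  intro g hg htd
  have hℓ : Nat.Prime ℓ := Fact.out
  obtain ⟨a, ht, hd⟩ := exists_double_root htd
  have ha : a ≠ 0 := by
    rintro rfl
    exact det_val_ne_zero g (by rw [hd]; ring)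
  have hsq : (g.val - a • 1) ^ 2 = 0 := by
    have h1 : (g.val - a • 1) ^ 2 = g.val * g.val - (2 * a) • g.val + a ^ 2 • 1 := by
      rw [pow_two, sub_mul, mul_sub, mul_sub]
      simp only [smul_mul_assoc, mul_smul_comm, one_mul, mul_one, smul_smul]
      module
    rw [h1, sq_eq, ht, hd]
    module
  have hpow : g.val ^ ℓ = a • 1 := by
    have h1 : (g.val - a • 1) ^ ℓ = 0 := pow_eq_zero_of_le hℓ.two_le hsq
    rw [sub_pow_char_of_commute ℓ ((Commute.one_right _).smul_right a), smul_pow, one_pow,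
      ZMod.pow_card] at h1
    exact sub_eq_zero.1 h1
  have h1 : (g ^ (ℓ - 1)) ^ ℓ = 1 := by
    apply Units.ext
    rw [← pow_mul, mul_comm, pow_mul, Units.val_pow_eq_pow_val, Units.val_pow_eq_pow_val, hpow,
      smul_pow, one_pow, ZMod.pow_card_sub_one_eq_one ha, one_smul, Units.val_one]
  have h2 : g ^ (ℓ - 1) = 1 := by
    rcases (Nat.dvd_prime hℓ).1 (orderOf_dvd_of_pow_eq_one h1) with h | h
    · exact orderOf_eq_one_iff.1 h
    · exact absurd h (hord _ (G.pow_mem hg _))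
  have h3 : g.val ^ ℓ = g.val := by
    rw [← Units.val_pow_eq_pow_val, ← pow_sub_one_mul hℓ.ne_zero g, h2, one_mul]
  exact isScal_iff.2 ⟨a, h3.symm.trans hpow⟩

theorem trace_det_of_orderOf_eq {h : GL2 ℓ} (hh : orderOf h = ℓ) :
    h.val.trace = 2 ∧ h.val.det = 1 := by
  have hpow : h.val ^ ℓ = 1 := by
    rw [← Units.val_pow_eq_pow_val, orderOf_dvd_iff_pow_eq_one.1 hh.dvd, Units.val_one]
  have hnil : (h.val - 1) ^ ℓ = 0 := by
    rw [sub_pow_char_of_commute ℓ (Commute.one_right _), one_pow, hpow, sub_self]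
  have htr : (h.val - 1).trace = 0 :=
    (Matrix.isNilpotent_trace_of_isNilpotent ⟨ℓ, hnil⟩).eq_zero
  have hdet : (h.val - 1).det = 0 := by
    have := congrArg Matrix.det hnil
    rw [Matrix.det_pow, Matrix.det_zero] at this
    exact pow_eq_zero_iff (Nat.Prime.ne_zero Fact.out) |>.1 this
  rw [Matrix.trace_fin_two] at htr ⊢
  rw [Matrix.det_fin_two] at hdet ⊢
  simp only [Matrix.sub_apply, Matrix.one_apply_eq, Matrix.one_apply_ne one_ne_zero,
    Matrix.one_apply_ne zero_ne_one] at htr hdet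
  exact ⟨by linear_combination htr, by linear_combination hdet + htr⟩

theorem dimOne_eq_two_iff {g : GL2 ℓ} : dimOne g = 2 ↔ g = 1 := by
  have h2 : Module.finrank (ZMod ℓ) (Fin 2 → ZMod ℓ) = 2 := by simp
  constructor
  · intro h
    have h1 := Submodule.eq_top_of_finrank_eq (h.trans h2.symm)
    rw [LinearMap.ker_eq_top, LinearEquiv.map_eq_zero_iff, sub_eq_zero] at h1
    exact Units.ext h1
  · rintro rfl
    have h1 : mat (1 : GL2 ℓ) - 1 = 0 := sub_self _
    rw [dimOne, h1, map_zero, LinearMap.ker_zero, finrank_top, h2]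

theorem orderOf_ne_of_sigSet_eq (hsig : sigSet G = sigSet H) (hG : NoUnip G) :
    ∀ h ∈ H, orderOf h ≠ ℓ := by
  intro h hh hord
  obtain ⟨ht, hd⟩ := trace_det_of_orderOf_eq hord
  obtain ⟨g, hg, hgh⟩ : sigOf h ∈ sigSet G := hsig ▸ ⟨h, hh, rfl⟩
  simp only [sigOf, Prod.mk.injEq] at hgh
  obtain ⟨hd', ht', hdim⟩ := hgh
  have ht' : g.val.trace = 2 := ht'.trans ht
  have hd' : g.val.det = 1 := hd'.trans hd
  obtain ⟨a, ha⟩ := isScal_iff.1 (hG g hg (by rw [ht', hd']; norm_num))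
  have hg1 : g = 1 := by
    rw [ha, Matrix.trace_smul, Matrix.trace_one, smul_eq_mul] at ht'
    rw [ha, Matrix.det_smul, Matrix.det_one] at hd'
    simp only [Fintype.card_fin, Nat.cast_ofNat, mul_one] at ht' hd'
    have ha1 : (a - 1) ^ 2 = 0 := by linear_combination hd' - ht'
    rw [sub_eq_zero.1 (pow_eq_zero_iff two_ne_zero |>.1 ha1), one_smul] at ha
    exact Units.ext ha
  rw [dimOne_eq_two_iff.2 hg1, eq_comm, dimOne_eq_two_iff] at hdim
  rw [hdim, orderOf_one] at hord
  exact Nat.Prime.ne_one Fact.out hord.symm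

theorem sigLE_of_sigSet_eq (hsig : sigSet G = sigSet H) : SigLE G H := by
  intro g hg
  obtain ⟨h, hh, hgh⟩ : sigOf g ∈ sigSet H := hsig ▸ ⟨g, hg, rfl⟩
  simp only [sigOf, Prod.mk.injEq] at hgh
  exact ⟨h, hh, hgh.2.1, hgh.1⟩

theorem natCast_ne_zero_of_dvd_card (hord : ∀ g ∈ G, orderOf g ≠ ℓ) (p : ℕ) (hp : p.Prime)
    (hpG : p ∣ Nat.card G) : (p : ZMod ℓ) ≠ 0 := by
  intro h
  obtain rfl := (Nat.prime_dvd_prime_iff_eq Fact.out hp).1 ((ZMod.natCast_eq_zero_iff p ℓ).1 h)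
  obtain ⟨g, hg⟩ := exists_prime_orderOf_dvd_card' ℓ hpG
  exact hord g g.2 ((Subgroup.orderOf_coe g).trans hg)

end PrimeField

/-- Let `ℓ` be a prime and let `G` and `H` be subgroups of `GL₂(ℤ/ℓℤ)` with
`sig(G) = sig(H)` that are not conjugate, such that `G` contains no element of order `ℓ`.
Then `|z(G) − z(H)| ≥ 1/4`. -/
theorem stmt15 (ℓ : ℕ) [Fact (Nat.Prime ℓ)]
    (G H : Subgroup (GL2 ℓ))
    (hsig : sigSet G = sigSet H)
    (hnconj : ¬ ConjSub G H)
    (hord : ∀ g ∈ G, orderOf g ≠ ℓ) :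
    (1 : ℚ) / 4 ≤ |zRatio G - zRatio H| := by
  have hG := noUnip_of_orderOf_ne hord
  have hord' := orderOf_ne_of_sigSet_eq hsig hG
  exact (exists_conj_or_quarter_le hG (noUnip_of_orderOf_ne hord') (sigLE_of_sigSet_eq hsig)
    (sigLE_of_sigSet_eq hsig.symm) (natCast_ne_zero_of_dvd_card hord)
    (natCast_ne_zero_of_dvd_card hord')).resolve_left hnconj
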